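/- arXiv:1410.5804 — 3 statements merged into one kernel-verified Lean document; each statement's English description precedes it below -/
import Mathlib

section
/- Fix R > 1 and let ℓ = {z ∈ ℍ : |z| = 1/R} and ℓ' = {z ∈ ℍ : |z| = R}. Let g, g' ∈ PSL(2,ℝ). If g⁻¹g' ∈ SQ(ℓ)·SQ(ℓ')⁻¹ = {q·p : q ∈ SQ(ℓ), p ∈ SQ(ℓ')⁻¹}, and moreover g·ℓ ∩ g'·ℓ' = ∅, g·({z ∈ ℍ : |z| < 1/R}) ∩ g'·ℓ' = ∅, and g'·({z ∈ ℍ : |z| > R}) ∩ g·ℓ = ∅ (the images of ℓ and ℓ' under g and g' are disjoint and transversely oriented away from each other for the induced orientations), then the right AdS crooked planes g·C*(ℓ) and g'·C*(ℓ') are disjoint. -/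
noncomputable section

open Filter Topology Pointwise
open scoped UpperHalfPlane

/-- `SL(2,ℝ)`. -/
abbrev SL2 := Matrix.SpecialLinearGroup (Fin 2) ℝ

instance : TopologicalSpace SL2 :=
  TopologicalSpace.induced (fun A : SL2 => (A : Matrix (Fin 2) (Fin 2) ℝ)) inferInstance

/-- `PSL(2,ℝ) = SL(2,ℝ)/{±I}`. -/
abbrev PSL2 := SL2 ⧸ Subgroup.center SL2

/-- The Möbius action of an element of `PSL(2,ℝ)` on the upper half-plane,
computed via an (arbitrary) lift to `SL(2,ℝ)`; this is well defined since
`-I` acts trivially. -/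
def pslSMul (g : PSL2) (z : ℍ) : ℍ := (Quotient.out g) • z

/-- Image of a subset of `ℍ` under the Möbius action of `g ∈ PSL(2,ℝ)`. -/
def pslImg (g : PSL2) (s : Set ℍ) : Set ℍ := pslSMul g '' s

/-- A geodesic line of `ℍ`: the image of an isometric embedding of `ℝ` into `ℍ`. -/
def IsGeodesicLine (l : Set ℍ) : Prop := ∃ γ : ℝ → ℍ, Isometry γ ∧ Set.range γ = l

/-- The embedding of `ℍ` into the one-point compactification of `ℂ`. -/
def embH (z : ℍ) : OnePoint ℂ := ((z : ℂ) : OnePoint ℂ)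

/-- The embedding of `∂∞ℍ = ℝ ∪ {∞}` into the one-point compactification of `ℂ`. -/
def toC : OnePoint ℝ → OnePoint ℂ := OnePoint.map Complex.ofReal

/-- The vector `v(ξ) ∈ ℝ²` associated with a boundary point `ξ ∈ ℝ ∪ {∞}`:
`v(ξ) = (ξ, 1)` for `ξ ∈ ℝ` and `v(∞) = (1, 0)`. -/
def bvec (ξ : OnePoint ℝ) : Fin 2 → ℝ := Option.elim ξ ![1, 0] (fun r => ![r, 1])

/-- The extended Möbius action of `PSL(2,ℝ)` on `∂∞ℍ = ℝ ∪ {∞}`. -/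
def bdSMul (g : PSL2) (ξ : OnePoint ℝ) : OnePoint ℝ :=
  let w := ((Quotient.out g : SL2) : Matrix (Fin 2) (Fin 2) ℝ).mulVec (bvec ξ)
  if w 1 = 0 then OnePoint.infty else ((w 0 / w 1 : ℝ) : OnePoint ℝ)

/-- `ξ ∈ ℝ ∪ {∞}` is an endpoint of the geodesic line `l`: some isometric
parametrization of `l` tends to `ξ` (in the one-point compactification of `ℂ`). -/
def IsEndpoint (l : Set ℍ) (ξ : OnePoint ℝ) : Prop :=
  ∃ γ : ℝ → ℍ, Isometry γ ∧ Set.range γ = l ∧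
    Tendsto (fun t => embH (γ t)) atTop (𝓝 (toC ξ))

/-- `h ∈ PSL(2,ℝ)` has a nonattracting fixed point at `ξ ∈ ℝ ∪ {∞}`. -/
def HasNonattracting (h : PSL2) (ξ : OnePoint ℝ) : Prop :=
  ∃ A : SL2, (QuotientGroup.mk A : PSL2) = h ∧
    ∃ μ : ℝ, |μ| ≤ 1 ∧ (A : Matrix (Fin 2) (Fin 2) ℝ).mulVec (bvec ξ) = μ • bvec ξ

/-- `h ∈ PSL(2,ℝ)` has a nonrepelling fixed point at `ξ ∈ ℝ ∪ {∞}`. -/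
def HasNonrepelling (h : PSL2) (ξ : OnePoint ℝ) : Prop :=
  ∃ A : SL2, (QuotientGroup.mk A : PSL2) = h ∧
    ∃ μ : ℝ, 1 ≤ |μ| ∧ (A : Matrix (Fin 2) (Fin 2) ℝ).mulVec (bvec ξ) = μ • bvec ξ

/-- The right AdS crooked plane `C*(l)` centered at the identity. -/
def rightCrooked (l : Set ℍ) : Set PSL2 :=
  {h | (∃ x ∈ l, pslSMul h x = x) ∨ ∃ ξ, IsEndpoint l ξ ∧ HasNonattracting h ξ}

/-- The left AdS crooked plane `C(l)` centered at the identity. -/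
def leftCrooked (l : Set ℍ) : Set PSL2 :=
  {h | (∃ x ∈ l, pslSMul h x = x) ∨ ∃ ξ, IsEndpoint l ξ ∧ HasNonrepelling h ξ}

/-- A general right AdS crooked plane: a set of the form `g·C*(l)`. -/
def IsRightCrookedPlane (S : Set PSL2) : Prop :=
  ∃ (g : PSL2) (l : Set ℍ), IsGeodesicLine l ∧ S = (g * ·) '' rightCrooked l

/-- A general left AdS crooked plane: a set of the form `C(l)·g`. -/
def IsLeftCrookedPlane (S : Set PSL2) : Prop :=
  ∃ (g : PSL2) (l : Set ℍ), IsGeodesicLine l ∧ S = (· * g) '' leftCrooked l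

variable {Γ : Type*} [Group Γ]

/-- The action `γ·x = ρ(γ) x j(γ)⁻¹` of `Γ` on `PSL(2,ℝ)`, applied to a set. -/
def actImg (j ρ : Γ →* PSL2) (γ : Γ) (S : Set PSL2) : Set PSL2 :=
  (fun x => ρ γ * x * (j γ)⁻¹) '' S

/-- The action `γ·x = ρ(γ) x j(γ)⁻¹` is properly discontinuous. -/
def ProperlyDisc (j ρ : Γ →* PSL2) : Prop :=
  ∀ K : Set PSL2, IsCompact K → {γ : Γ | (actImg j ρ γ K ∩ K).Nonempty}.Finite

/-- `R` is a fundamental domain for the action `γ·x = ρ(γ) x j(γ)⁻¹`: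
`R` is closed, its translates cover `PSL(2,ℝ)`, and the interiors of the
translates are pairwise disjoint. -/
def IsFundDom (j ρ : Γ →* PSL2) (R : Set PSL2) : Prop :=
  IsClosed R ∧ (⋃ γ : Γ, actImg j ρ γ R) = Set.univ ∧
    Pairwise fun γ₁ γ₂ : Γ =>
      Disjoint (interior (actImg j ρ γ₁ R)) (interior (actImg j ρ γ₂ R))

/-- The action admits a fundamental domain bounded by pairwise disjoint
right AdS crooked planes. -/
def AdmitsRightCrookedFD (j ρ : Γ →* PSL2) : Prop :=
  ∃ (m : ℕ) (D : Fin m → Set PSL2), (∀ i, IsRightCrookedPlane (D i)) ∧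
    (∀ (γ γ' : Γ) (i i' : Fin m),
      actImg j ρ γ (D i) = actImg j ρ γ' (D i') ∨
      Disjoint (actImg j ρ γ (D i)) (actImg j ρ γ' (D i'))) ∧
    ∃ x ∈ (⋃ (γ : Γ) (i : Fin m), actImg j ρ γ (D i))ᶜ,
      IsFundDom j ρ
        (closure (connectedComponentIn (⋃ (γ : Γ) (i : Fin m), actImg j ρ γ (D i))ᶜ x))

/-- The action admits a fundamental domain bounded by pairwise disjoint
left AdS crooked planes. -/
def AdmitsLeftCrookedFD (j ρ : Γ →* PSL2) : Prop :=
  ∃ (m : ℕ) (D : Fin m → Set PSL2), (∀ i, IsLeftCrookedPlane (D i)) ∧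
    (∀ (γ γ' : Γ) (i i' : Fin m),
      actImg j ρ γ (D i) = actImg j ρ γ' (D i') ∨
      Disjoint (actImg j ρ γ (D i)) (actImg j ρ γ' (D i'))) ∧
    ∃ x ∈ (⋃ (γ : Γ) (i : Fin m), actImg j ρ γ (D i))ᶜ,
      IsFundDom j ρ
        (closure (connectedComponentIn (⋃ (γ : Γ) (i : Fin m), actImg j ρ γ (D i))ᶜ x))

/-- The translation length `λ(g) = inf_{p ∈ ℍ} d(p, g·p)`. -/
def transLength (g : PSL2) : ℝ := ⨅ p : ℍ, dist p (pslSMul g p)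

/-- `U` is a connected component of `S`. -/
def IsCC (S U : Set ℍ) : Prop := ∃ x ∈ S, connectedComponentIn S x = U

/-- `ξ ∈ ℝ ∪ {∞}` is an ideal point of `U ⊆ ℍ`: a limit of a sequence of points
of `U` in the one-point compactification of `ℂ`. -/
def IsIdealPoint (U : Set ℍ) (ξ : OnePoint ℝ) : Prop :=
  ∃ u : ℕ → ℍ, (∀ n, u n ∈ U) ∧ Tendsto (fun n => embH (u n)) atTop (𝓝 (toC ξ))

/-- The closed right crooked half-space `H̄*₊(l, U)`. -/
def closedRHS (l U : Set ℍ) : Set PSL2 :=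
  {h | (∃ x ∈ l ∪ U, pslSMul h x = x) ∨ ∃ ξ, IsIdealPoint U ξ ∧ HasNonattracting h ξ}

/-- The open right crooked half-space `H*₊(l, U)`. -/
def openRHS (l U : Set ℍ) : Set PSL2 :=
  {h | h ≠ 1 ∧ ((∃ x ∈ U, pslSMul h x = x) ∨
    ∃ ξ, IsIdealPoint U ξ ∧ ¬ IsEndpoint l ξ ∧ HasNonattracting h ξ)}

/-- The circle of (Euclidean) radius `c` in `ℍ` centered at `0`; for suitable `c`
this is a geodesic line of `ℍ`. -/
def circ (c : ℝ) : Set ℍ := {z : ℍ | ‖(z : ℂ)‖ = c}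

/-- The stem quadrant `SQ(ℓ)` for `ℓ = {|z| = 1/R}` transversely oriented towards `0`. -/
def SQell (R : ℝ) : Set PSL2 :=
  {h | ∃ (A : SL2) (α β v : ℝ), (QuotientGroup.mk A : PSL2) = h ∧
    (A : Matrix (Fin 2) (Fin 2) ℝ) = !![α, -v/R; v*R, β] ∧
    |α| < |β| ∧ 2*|v| < |α - β|}

/-- The inverse stem quadrant `SQ(ℓ')⁻¹` for `ℓ' = {|z| = R}` transversely
oriented towards `∞`. -/
def SQell'inv (R : ℝ) : Set PSL2 :=
  {h | ∃ (A : SL2) (α β v : ℝ), (QuotientGroup.mk A : PSL2) = h ∧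
    (A : Matrix (Fin 2) (Fin 2) ℝ) = !![α, v*R; -v/R, β] ∧
    |α| < |β| ∧ 2*|v| < |α - β|}

/-- The stem quadrant `SQ(ℓ')`. -/
def SQell' (R : ℝ) : Set PSL2 := {h | h⁻¹ ∈ SQell'inv R}


/-- data of normalized stem quadrant element -/
theorem sq_basic {α β v : ℝ} (hd : α*β + v^2 = 1) (hb : 0 < β) (h1 : |α| < |β|) (h2 : 2*|v| < |α-β|) :
    2 < α + β ∧ 1 + v < β ∧ 1 - v < β ∧ 2*v < β - α ∧ -2*v < β - α := by
  rw [abs_of_pos hb] at h1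
  have h3 := abs_lt.1 h1
  rw [abs_sub_comm, abs_of_pos (by linarith : 0 < β - α)] at h2
  have h4 := le_abs_self v
  have h5 := neg_abs_le v
  have h6 : 4*v^2 < (β-α)^2 := by
    have := abs_nonneg v
    have h7 := sq_abs v
    nlinarith
  have h8 : 2 < α + β := by
    by_contra h
    push Not at h
    nlinarith
  refine ⟨h8, ?_, ?_, ?_, ?_⟩ <;> linarith

/-- `a < 1` -/
theorem lt_one_aux {a b c d : ℝ} (hab : a + b = c + d) (hd : a*d + c*b = 2) (ha : 0 < a) (hc : 0 < c)
    (hb : 1 < b) (hdd : 1 < d) : a < 1 := by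
  by_contra h
  push Not at h
  nlinarith [mul_pos ha hc, mul_pos hc (by linarith : 0 < b - 1), mul_pos ha (by linarith : 0 < d - 1)]

theorem opp_aux {a b c d a' b' c' d' : ℝ} (hab : a + b = c + d) (hd : a*d + c*b = 2)
    (ha : 0 < a) (hc : 0 < c) (ha1 : a < 1) (hc1 : c < 1) (hb : 1 < b) (hdd : 1 < d)
    (ht : 2 < a + b)
    (hab' : a' + b' = c' + d') (hd' : a'*d' + c'*b' = 2)
    (ha' : 0 < a') (hc' : 0 < c') (ha1' : a' < 1) (hc1' : c' < 1) (hb' : 1 < b') (hdd' : 1 < d')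
    (ht' : 2 < a' + b') :
    2*a*b < a*a' + b*b' ∨ 2*c'*d' < c*c' + d*d' := by
  by_contra h
  push Not at h
  obtain ⟨h1, h2⟩ := h
  have e1 : (a+c)*b = 2 + a*c - a^2 := by
    have : d = a + b - c := by linarith
    subst this; linarith
  have e2 : (a'+c')*d' = 2 + a'*c' - c'^2 := by
    have : b' = c' + d' - a' := by linarith
    subst this; linarith
  have f1 : 2*b*(1-a) < a'*(b-a) := by nlinarith
  have f2 : 2*d'*(1-c') < c*(d'-c') := by nlinarith
  have g1 : 2 + a*c - a^2 < a'*(1+a) := by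
    have := mul_lt_mul_of_pos_right f1 (by linarith : 0 < a + c)
    have h3 : 2*(1-a)*(2 + a*c - a^2) < 2*(1-a)*(a'*(1+a)) := by
      rw [← e1]; linear_combination this + a' * e1
    exact lt_of_mul_lt_mul_left h3 (by linarith)
  have g2 : 2 + a'*c' - c'^2 < c*(1+c') := by
    have := mul_lt_mul_of_pos_right f2 (by linarith : 0 < a' + c')
    have h3 : 2*(1-c')*(2 + a'*c' - c'^2) < 2*(1-c')*(c*(1+c')) := by
      rw [← e2]; linear_combination this + c * e2
    exact lt_of_mul_lt_mul_left h3 (by linarith)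
  rcases le_total a c' with h | h
  · nlinarith [mul_nonneg (sub_nonneg.2 h) (by linarith : 0 ≤ 1 - c + a'), mul_pos ha ha]
  · nlinarith [mul_nonneg (sub_nonneg.2 h) (by linarith : 0 ≤ 1 + c - a')]

theorem opp_lt {a b c d a' b' c' d' ρ : ℝ} (hab : a + b = c + d) (hd : a*d + c*b = 2)
    (ha : 0 < a) (hc : 0 < c) (ha1 : a < 1) (hc1 : c < 1) (hb : 1 < b) (hdd : 1 < d)
    (ht : 2 < a + b)
    (hab' : a' + b' = c' + d') (hd' : a'*d' + c'*b' = 2)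
    (ha' : 0 < a') (hc' : 0 < c') (ha1' : a' < 1) (hc1' : c' < 1) (hb' : 1 < b') (hdd' : 1 < d')
    (ht' : 2 < a' + b') (hS : b*b' ≤ ρ*(a*a')) (hT : d*d' ≤ ρ*(c*c')) :
    b*d' + ρ*(a*c') < ρ + 1 := by
  have hy : 0 < 1 - a*c' := by nlinarith
  rcases opp_aux hab hd ha hc ha1 hc1 hb hdd ht hab' hd' ha' hc' ha1' hc1' hb' hdd' ht' with h | h
  · have hp : 0 < a*a' := mul_pos ha ha'
    have : (a*a')*(b*d' + ρ*(a*c')) < (a*a')*(ρ+1) := by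
      have := mul_le_mul_of_nonneg_right hS hy.le
      have h3 : b*d'*(a*a') - a*a' < b*b'*(1-a*c') := by
        have : b*a*(a'*d' + c'*b') = b*a*2 := by rw [hd']
        linarith
      linarith
    exact lt_of_mul_lt_mul_left this hp.le
  · have hp : 0 < c*c' := mul_pos hc hc'
    have : (c*c')*(b*d' + ρ*(a*c')) < (c*c')*(ρ+1) := by
      have := mul_le_mul_of_nonneg_right hT hy.le
      have h3 : b*d'*(c*c') - c*c' < d*d'*(1-a*c') := by
        have : d'*c'*(a*d + c*b) = d'*c'*2 := by rw [hd]
        linarith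
      linarith
    exact lt_of_mul_lt_mul_left this hp.le

/-- contradiction from cross ratios -/
theorem cross_aux {x y x' y' ρ b d b' d' : ℝ} (hx : 0 < x) (hy : 0 < y) (hx' : 0 < x') (hy' : 0 < y')
    (hb : 0 < b) (hd : 0 < d) (hb' : 0 < b') (hd' : 0 < d') (hρ : 0 < ρ)
    (h1 : ρ*(x*y') < b*d') (h2 : ρ*(y*x') < d*b') (h3 : b*b' ≤ ρ*(x*x')) (h4 : d*d' ≤ ρ*(y*y')) : False := by
  have e1 : (ρ*(x*y'))*(ρ*(y*x')) < (b*d')*(d*b') :=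
    mul_lt_mul h1 h2.le (by positivity) (by positivity)
  have e2 : (b*b')*(d*d') ≤ (ρ*(x*x'))*(ρ*(y*y')) :=
    mul_le_mul h3 h4 (by positivity) (by positivity)
  nlinarith

theorem cross_aux' {x y x' y' ρ b d b' d' : ℝ} (hx : 0 < x) (hy : 0 < y) (hx' : 0 < x') (hy' : 0 < y')
    (hb : 0 < b) (hd : 0 < d) (hb' : 0 < b') (hd' : 0 < d') (hρ : 0 < ρ)
    (h1 : b*d' < ρ*(x*y')) (h2 : d*b' < ρ*(y*x')) (h3 : ρ*(x*x') ≤ b*b') (h4 : ρ*(y*y') ≤ d*d') : False := by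
  have e1 : (b*d')*(d*b') < (ρ*(x*y'))*(ρ*(y*x')) :=
    mul_lt_mul h1 h2.le (by positivity) (by positivity)
  have e2 : (ρ*(x*x'))*(ρ*(y*y')) ≤ (b*b')*(d*d') :=
    mul_le_mul h3 h4 (by positivity) (by positivity)
  nlinarith

theorem mul_lt_one_aux {x y : ℝ} (hx : 0 < x) (hx1 : x < 1) (hy1 : y < 1) : x*y < 1 := by
  nlinarith

theorem one_lt_mul_aux {x y : ℝ} (hx1 : 1 < x) (hy1 : 1 < y) : 1 < x*y := by
  nlinarith

theorem nonpos_aux {x y : ℝ} (h : 0 ≤ x*y) (hx : y < 0) : x ≤ 0 := by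
  by_contra hc
  push Not at hc
  nlinarith

theorem nonpos_aux' {x y : ℝ} (h : 0 ≤ x*y) (hx : x < 0) : y ≤ 0 := by
  by_contra hc
  push Not at hc
  nlinarith

theorem four_signs_aux {S T O P ρ : ℝ} (hρ : 0 < ρ) (hid : O*P = 4*ρ + S*T)
    (k1 : 0 ≤ S*O) (k2 : 0 ≤ T*P) (k3 : 0 ≤ S*P) (k4 : 0 ≤ T*O) (k5 : 0 < S*O + T*P)
    (noneg : O < 0 → P < 0 → S ≤ 0 → T ≤ 0 → False) : 0 ≤ S ∧ 0 ≤ T := by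
  by_contra hcon
  have hOP : O ≤ 0 ∧ P ≤ 0 := by
    by_cases hs : S < 0
    · exact ⟨nonpos_aux' k1 hs, nonpos_aux' k3 hs⟩
    · have ht : T < 0 := by
        by_contra h; exact hcon ⟨by linarith, by linarith⟩
      exact ⟨nonpos_aux' k4 ht, nonpos_aux' k2 ht⟩
  by_cases hO0 : O = 0
  · subst hO0
    have hPn : P < 0 := lt_of_le_of_ne hOP.2 (by rintro rfl; simp at k5)
    have hTn : T ≤ 0 := nonpos_aux k2 hPn
    have hSn : S ≤ 0 := nonpos_aux k3 hPn
    have := mul_nonneg_of_nonpos_of_nonpos hSn hTn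
    linarith
  · have hOn : O < 0 := lt_of_le_of_ne hOP.1 hO0
    have hSn : S ≤ 0 := nonpos_aux k1 hOn
    have hTn : T ≤ 0 := nonpos_aux k4 hOn
    have := mul_nonneg_of_nonpos_of_nonpos hSn hTn
    have hPn : P < 0 := lt_of_le_of_ne hOP.2 (by rintro rfl; linarith)
    exact noneg hOn hPn hSn hTn

/-- sign analysis: positivity conclusions. -/
theorem sign_aux {a b c d a' b' c' d' ρ : ℝ} (hρ : 0 < ρ) (hd : a*d + c*b = 2)
    (hb : 1 < b) (hdd : 1 < d)
    (hd' : a'*d' + c'*b' = 2) (hb' : 1 < b') (hdd' : 1 < d')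
    (k1 : 0 ≤ (ρ*(a*a') - b*b')*(ρ*(a*c') + b*d'))
    (k2 : 0 ≤ (ρ*(c*c') - d*d')*(ρ*(c*a') + d*b'))
    (k3 : 0 ≤ (ρ*(a*a') - b*b')*(ρ*(c*a') + d*b'))
    (k4 : 0 ≤ (ρ*(c*c') - d*d')*(ρ*(a*c') + b*d'))
    (k5 : 0 < (ρ*(a*a') - b*b')*(ρ*(a*c') + b*d') + (ρ*(c*c') - d*d')*(ρ*(c*a') + d*b')) :
    (0 < a ∧ 0 < c ∧ 0 < a' ∧ 0 < c') ∧ b*b' ≤ ρ*(a*a') ∧ d*d' ≤ ρ*(c*c') := by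
  have hb0 : 0 < b := by linarith
  have hd0 : 0 < d := by linarith
  have hb0' : 0 < b' := by linarith
  have hd0' : 0 < d' := by linarith
  have hid : (ρ*(a*c') + b*d')*(ρ*(c*a') + d*b')
      = 4*ρ + (ρ*(a*a') - b*b')*(ρ*(c*c') - d*d') := by
    have : (a*d + c*b)*(a'*d' + c'*b') = 4 := by rw [hd, hd']; norm_num
    linear_combination ρ * this
  have n1 : 0 < a ∨ 0 < c := by
    by_contra h; push Not at h; nlinarith [h.1, h.2]
  have n2 : 0 < a' ∨ 0 < c' := by
    by_contra h; push Not at h; nlinarith [h.1, h.2]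
  have key : ρ*(a*c') + b*d' < 0 → ρ*(c*a') + d*b' < 0 →
      (0 < a ∧ c < 0 ∧ 0 < a' ∧ c' < 0) ∨ (a < 0 ∧ 0 < c ∧ a' < 0 ∧ 0 < c') := by
    intro o1 o2
    have p1 : a*c' < 0 := by
      by_contra h; push Not at h; nlinarith [mul_nonneg hρ.le h, mul_pos hb0 hd0']
    have p2 : c*a' < 0 := by
      by_contra h; push Not at h; nlinarith [mul_nonneg hρ.le h, mul_pos hd0 hb0']
    rcases mul_neg_iff.1 p1 with ⟨q1, q2⟩ | ⟨q1, q2⟩ <;>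
    rcases mul_neg_iff.1 p2 with ⟨q3, q4⟩ | ⟨q3, q4⟩ <;> grind
  have noneg : ρ*(a*c') + b*d' < 0 → ρ*(c*a') + d*b' < 0 → 
      ρ*(a*a') - b*b' ≤ 0 → ρ*(c*c') - d*d' ≤ 0 → False := by
    intro o1 o2 s1 s2
    rcases key o1 o2 with ⟨q1, q2, q3, q4⟩ | ⟨q1, q2, q3, q4⟩
    · exact cross_aux' q1 (neg_pos.2 q2) q3 (neg_pos.2 q4) hb0 hd0 hb0' hd0' hρ
        (by linarith) (by linarith) (by linarith) (by linarith)
    · exact cross_aux' (neg_pos.2 q1) q2 (neg_pos.2 q3) q4 hb0 hd0 hb0' hd0' hρ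
        (by linarith) (by linarith) (by linarith) (by linarith)
  set S := ρ*(a*a') - b*b' with hS
  set T := ρ*(c*c') - d*d' with hT
  set O := ρ*(a*c') + b*d' with hO
  set P := ρ*(c*a') + d*b' with hP
  have hS0 : 0 ≤ S ∧ 0 ≤ T := four_signs_aux hρ hid k1 k2 k3 k4 k5 noneg
  obtain ⟨hS0, hT0⟩ := hS0
  have hOP : 0 < O * P := by rw [hid]; positivity
  have hpos : 0 < O ∧ 0 < P := by
    rcases mul_pos_iff.1 hOP with h | h
    · exact h
    · exfalso
      exact noneg h.1 h.2 (nonpos_aux k1 h.1) (nonpos_aux k4 h.1)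
  have p1 : 0 < a*a' := by
    by_contra h; push Not at h; nlinarith [mul_pos hb0 hb0', mul_nonneg hρ.le (neg_nonneg.2 h)]
  have p2 : 0 < c*c' := by
    by_contra h; push Not at h; nlinarith [mul_pos hd0 hd0', mul_nonneg hρ.le (neg_nonneg.2 h)]
  refine ⟨?_, by linarith, by linarith⟩
  rcases mul_pos_iff.1 p1 with ⟨q1, q2⟩ | ⟨q1, q2⟩ <;>
  rcases mul_pos_iff.1 p2 with ⟨q3, q4⟩ | ⟨q3, q4⟩
  · exact ⟨q1, q3, q2, q4⟩
  · exfalso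
    exact cross_aux q1 (neg_pos.2 q3) q2 (neg_pos.2 q4) hb0 hd0 hb0' hd0' hρ
        (by linarith) (by linarith) (by linarith) (by linarith)
  · exfalso
    exact cross_aux (neg_pos.2 q1) q3 (neg_pos.2 q2) q4 hb0 hd0 hb0' hd0' hρ
        (by linarith) (by linarith) (by linarith) (by linarith)
  · grind

/-- affine function negative on the open interval -/
theorem affine_aux {A B : ℝ} (h : ∀ x : ℝ, -1 < x → x < 1 → 0 < A + B*x) :
    0 < A ∧ 0 ≤ A + B ∧ 0 ≤ A - B := by
  have h0 := h 0 (by norm_num) (by norm_num)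
  have hA : 0 < A := by linarith
  refine ⟨hA, ?_, ?_⟩
  · by_contra hc
    push Not at hc
    have hB : B < 0 := by linarith
    have := h (-A/B) (by rw [lt_div_iff_of_neg hB]; linarith) (by rw [div_lt_iff_of_neg hB]; linarith)
    rw [mul_div_cancel₀ _ hB.ne] at this; linarith
  · by_contra hc
    push Not at hc
    have hB : 0 < B := by linarith
    have := h (-A/B) (by rw [lt_div_iff₀ hB]; linarith) (by rw [div_lt_iff₀ hB]; linarith)
    rw [mul_div_cancel₀ _ hB.ne'] at this; linarith

theorem core_pos {R α β v α' β' v' k1 k2 k3 k4 : ℝ} (hR : 1 < R)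
    (hd : α*β + v^2 = 1) (hb : 0 < β) (h1 : |α| < |β|) (h2 : 2*|v| < |α-β|)
    (hd' : α'*β' + v'^2 = 1) (hb' : 0 < β') (h1' : |α'| < |β'|) (h2' : 2*|v'| < |α'-β'|)
    (e1 : k1 = α*α' + v*v'/R^2) (e2 : k2 = α*v'*R - v*β'/R)
    (e3 : k3 = v*R*α' - β*v'/R) (e4 : k4 = v*v'*R^2 + β*β')
    (H1 : ∀ x : ℝ, -1 < x → x < 1 →
      0 < R^2*(k1^2*R^2+k2^2+2*k1*k2*R*x) - (k3^2*R^2+k4^2+2*k3*k4*R*x))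
    (H2 : ∀ x : ℝ, -1 < x → x < 1 →
      0 < R^2*(k3^2+k1^2*R^2-2*k3*k1*R*x) - (k4^2+k2^2*R^2-2*k4*k2*R*x))
    (e e' : ℝ) (he : e = 1 ∨ e = -1) (he' : e' = 1 ∨ e' = -1) :
    ((e/R)*(k3*e'*R+k4) - (k1*e'*R+k2))^2 < (e/R - e'*R)^2 := by
  obtain ⟨t1, t2, t3, t4, t5⟩ := sq_basic hd hb h1 h2
  obtain ⟨t1', t2', t3', t4', t5'⟩ := sq_basic hd' hb' h1' h2'
  have hR0 : 0 < R := by linarith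
  have hRn : R ≠ 0 := hR0.ne'
  have H1' := affine_aux (A := R^2*(k1^2*R^2+k2^2) - (k3^2*R^2+k4^2)) (B := R^2*(2*k1*k2*R) - 2*k3*k4*R)
    (fun x hx hx' => by have := H1 x hx hx'; linarith)
  have H2' := affine_aux (A := R^2*(k3^2+k1^2*R^2) - (k4^2+k2^2*R^2)) (B := R^2*(-2*k3*k1*R) + 2*k4*k2*R)
    (fun x hx hx' => by have := H2 x hx hx'; linarith)
  obtain ⟨u0, u1, u2⟩ := H1'
  obtain ⟨w0, w1, w2⟩ := H2'
  set a := α - v with ha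
  set c := α + v with hc
  set b := β + v with hbb
  set d := β - v with hdd
  set a' := α' + v' with ha'
  set c' := α' - v' with hc'
  set b' := β' - v' with hbb'
  set d' := β' + v' with hdd'
  have i1 : R*(k1*R+k2) - (k3*R+k4) = R^2*(a*a') - b*b' := by
    rw [e1,e2,e3,e4,ha,hbb,ha',hbb']; field_simp; ring
  have i2 : R*(k1*R-k2) - (k3*R-k4) = R^2*(a*c') + b*d' := by
    rw [e1,e2,e3,e4,ha,hbb,hc',hdd']; field_simp; ring
  have i3 : R*(k1*R+k2) + (k3*R+k4) = R^2*(c*a') + d*b' := by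
    rw [e1,e2,e3,e4,hc,hdd,ha',hbb']; field_simp; ring
  have i4 : R*(k1*R-k2) + (k3*R-k4) = R^2*(c*c') - d*d' := by
    rw [e1,e2,e3,e4,hc,hdd,hc',hdd']; field_simp; ring
  have hdet : a*d + c*b = 2 := by rw [ha,hdd,hc,hbb]; linarith
  have hdet' : a'*d' + c'*b' = 2 := by rw [ha',hdd',hc',hbb']; linarith
  have hab : a + b = c + d := by rw [ha,hdd,hc,hbb]; ring
  have hab' : a' + b' = c' + d' := by rw [ha',hdd',hc',hbb']; ring
  have hb1 : 1 < b := by rw [hbb]; linarith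
  have hd1 : 1 < d := by rw [hdd]; linarith
  have hb1' : 1 < b' := by rw [hbb']; linarith
  have hd1' : 1 < d' := by rw [hdd']; linarith
  obtain ⟨⟨pa, pc, pa', pc'⟩, hS, hT⟩ := sign_aux (ρ := R^2) (by positivity) hdet hb1 hd1 hdet' hb1' hd1'
    (by rw [← i1, ← i2]; linarith) (by rw [← i3, ← i4]; linarith)
    (by rw [← i1, ← i3]; linarith) (by rw [← i2, ← i4]; linarith)
    (by rw [← i1, ← i2, ← i3, ← i4]; linarith)
  have la := lt_one_aux hab hdet pa pc hb1 hd1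
  have lc := lt_one_aux hab.symm (by linarith : c*b + a*d = 2) pc pa hd1 hb1
  have la' := lt_one_aux hab' hdet' pa' pc' hb1' hd1'
  have lc' := lt_one_aux hab'.symm (by linarith : c'*b' + a'*d' = 2) pc' pa' hd1' hb1'
  have ht : 2 < a + b := by rw [ha, hbb]; linarith
  have ht' : 2 < a' + b' := by rw [ha', hbb']; linarith
  have o1 := opp_lt hab hdet pa pc la lc hb1 hd1 ht hab' hdet' pa' pc' la' lc' hb1' hd1' ht' hS hT
  have o2 := opp_lt hab.symm (by linarith : c*b + a*d = 2) pc pa lc la hd1 hb1 (by linarith)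
    hab'.symm (by linarith : c'*b' + a'*d' = 2) pc' pa' lc' la' hd1' hb1' (by linarith) hT hS
  have s1 : R^2*(a*a') - b*b' < R^2 - 1 := by
    have := mul_lt_one_aux pa la la'
    have := one_lt_mul_aux hb1 hb1'
    have := mul_lt_mul_of_pos_left (mul_lt_one_aux pa la la') (by positivity : 0 < R^2)
    linarith
  have s2 : R^2*(c*c') - d*d' < R^2 - 1 := by
    have := mul_lt_one_aux pc lc lc'
    have := one_lt_mul_aux hd1 hd1'
    have := mul_lt_mul_of_pos_left (mul_lt_one_aux pc lc lc') (by positivity : 0 < R^2)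
    linarith
  have hgoal : ∀ X Y : ℝ, X = Y/R → Y^2 < (e - e'*R^2)^2 → X^2 < (e/R - e'*R)^2 := by
    intro X Y hX hY
    have : (e/R - e'*R)^2 = (e - e'*R^2)^2/R^2 := by field_simp
    rw [hX, this, div_pow]
    gcongr
  apply hgoal _ (e*(k3*e'*R+k4) - R*(k1*e'*R+k2)) (by field_simp)
  have pp1 : 0 < R^2*(a*c') + b*d' := by positivity
  have pp2 : 0 < R^2*(c*a') + d*b' := by positivity
  rcases he with rfl | rfl <;> rcases he' with rfl | rfl
  · rw [show (1:ℝ)*(k3*1*R+k4) - R*(k1*1*R+k2) = -(R^2*(a*a') - b*b') by rw [← i1]; ring]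
    rw [neg_sq, show (1 - 1*R^2)^2 = (R^2-1)^2 by ring]
    exact pow_lt_pow_left₀ s1 (by linarith) (by norm_num)
  · rw [show (1:ℝ)*(k3*(-1)*R+k4) - R*(k1*(-1)*R+k2) = (R^2*(a*c') + b*d') by rw [← i2]; ring]
    rw [show (1 - (-1)*R^2)^2 = (R^2+1)^2 by ring]
    exact pow_lt_pow_left₀ (by linarith) (by linarith) (by norm_num)
  · rw [show (-1:ℝ)*(k3*1*R+k4) - R*(k1*1*R+k2) = -(R^2*(c*a') + d*b') by rw [← i3]; ring]
    rw [neg_sq, show (-1 - 1*R^2)^2 = (R^2+1)^2 by ring]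
    exact pow_lt_pow_left₀ (by linarith) (by linarith) (by norm_num)
  · rw [show (-1:ℝ)*(k3*(-1)*R+k4) - R*(k1*(-1)*R+k2) = (R^2*(c*c') - d*d') by rw [← i4]; ring]
    rw [show (-1 - (-1)*R^2)^2 = (R^2-1)^2 by ring]
    exact pow_lt_pow_left₀ s2 (by linarith) (by norm_num)
theorem core {R α β v α' β' v' k1 k2 k3 k4 σ : ℝ} (hR : 1 < R) (hσ : σ = 1 ∨ σ = -1)
    (hd : α*β + v^2 = 1) (h1 : |α| < |β|) (h2 : 2*|v| < |α-β|)
    (hd' : α'*β' + v'^2 = 1) (h1' : |α'| < |β'|) (h2' : 2*|v'| < |α'-β'|)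
    (e1 : k1 = σ*(α*α' + v*v'/R^2)) (e2 : k2 = σ*(α*v'*R - v*β'/R))
    (e3 : k3 = σ*(v*R*α' - β*v'/R)) (e4 : k4 = σ*(v*v'*R^2 + β*β'))
    (H1 : ∀ x : ℝ, -1 < x → x < 1 →
      0 < R^2*(k1^2*R^2+k2^2+2*k1*k2*R*x) - (k3^2*R^2+k4^2+2*k3*k4*R*x))
    (H2 : ∀ x : ℝ, -1 < x → x < 1 →
      0 < R^2*(k3^2+k1^2*R^2-2*k3*k1*R*x) - (k4^2+k2^2*R^2-2*k4*k2*R*x))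
    (e e' : ℝ) (he : e = 1 ∨ e = -1) (he' : e' = 1 ∨ e' = -1) :
    ((e/R)*(k3*e'*R+k4) - (k1*e'*R+k2))^2 < (e/R - e'*R)^2 := by
  have hb : β ≠ 0 := by rintro rfl; simp at h1; exact absurd h1 (not_lt.2 (abs_nonneg α))
  have hb' : β' ≠ 0 := by rintro rfl; simp at h1'; exact absurd h1' (not_lt.2 (abs_nonneg α'))
  obtain ⟨s, hs, hsβ⟩ : ∃ s : ℝ, (s = 1 ∨ s = -1) ∧ 0 < s*β := by
    rcases lt_or_gt_of_ne hb with h | h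
    · exact ⟨-1, Or.inr rfl, by linarith⟩
    · exact ⟨1, Or.inl rfl, by linarith⟩
  obtain ⟨s', hs', hsβ'⟩ : ∃ s : ℝ, (s = 1 ∨ s = -1) ∧ 0 < s*β' := by
    rcases lt_or_gt_of_ne hb' with h | h
    · exact ⟨-1, Or.inr rfl, by linarith⟩
    · exact ⟨1, Or.inl rfl, by linarith⟩
  have sq1 : σ*σ = 1 := by rcases hσ with rfl | rfl <;> norm_num
  have sq2 : s*s = 1 := by rcases hs with rfl | rfl <;> norm_num
  have sq3 : s'*s' = 1 := by rcases hs' with rfl | rfl <;> norm_num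
  have ab2 : |s| = 1 := by rcases hs with rfl | rfl <;> norm_num
  have ab3 : |s'| = 1 := by rcases hs' with rfl | rfl <;> norm_num
  set τ := σ*s*s' with hτ
  have sqτ : τ^2 = 1 := by rw [hτ]; linear_combination s^2*s'^2*sq1 + s'^2*sq2 + sq3
  have key := core_pos (R := R) (α := s*α) (β := s*β) (v := s*v) (α' := s'*α') (β' := s'*β') (v' := s'*v')
    (k1 := τ*k1) (k2 := τ*k2) (k3 := τ*k3) (k4 := τ*k4) hR
    (by linear_combination (α*β+v^2)*sq2 + hd) hsβ (by rw [abs_mul, abs_mul, ab2]; linarith)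
    (by rw [← mul_sub, abs_mul, abs_mul, ab2]; linarith)
    (by linear_combination (α'*β'+v'^2)*sq3 + hd') hsβ' (by rw [abs_mul, abs_mul, ab3]; linarith)
    (by rw [← mul_sub, abs_mul, abs_mul, ab3]; linarith)
    (by rw [e1, hτ]; linear_combination (s*s'*(α*α' + v*v'/R^2))*sq1)
    (by rw [e2, hτ]; linear_combination (s*s'*(α*v'*R - v*β'/R))*sq1)
    (by rw [e3, hτ]; linear_combination (s*s'*(v*R*α' - β*v'/R))*sq1)
    (by rw [e4, hτ]; linear_combination (s*s'*(v*v'*R^2 + β*β'))*sq1)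
    (fun x hx hx' => by
      have := H1 x hx hx'
      calc _ < _ := this
        _ = τ^2 * _ := by rw [sqτ, one_mul]
        _ = _ := by ring)
    (fun x hx hx' => by
      have := H2 x hx hx'
      calc _ < _ := this
        _ = τ^2 * _ := by rw [sqτ, one_mul]
        _ = _ := by ring) e e' he he'
  calc _ = τ^2 * ((e/R)*(k3*e'*R+k4) - (k1*e'*R+k2))^2 := by rw [sqτ, one_mul]
    _ = _ := by ring
    _ < _ := key

theorem mk_eq_sign {A B : SL2} (h : (QuotientGroup.mk A : PSL2) = QuotientGroup.mk B) :
    ∃ σ : ℝ, (σ = 1 ∨ σ = -1) ∧ (B : Matrix (Fin 2) (Fin 2) ℝ) = σ • (A : Matrix (Fin 2) (Fin 2) ℝ) := by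
  rw [QuotientGroup.eq] at h
  obtain ⟨r, hr, hr'⟩ := Matrix.SpecialLinearGroup.mem_center_iff.1 h
  refine ⟨r, ?_, ?_⟩
  · simpa using hr
  · have : B = A * (A⁻¹ * B) := by group
    rw [this, Matrix.SpecialLinearGroup.coe_mul, ← hr']
    ext i j
    simp [Matrix.mul_apply, Matrix.scalar_apply, Matrix.diagonal_apply, mul_comm]

theorem coe_out_smul (M : SL2) (z : ℍ) : ((M • z : ℍ) : ℂ) * ((M 1 0 : ℂ) * z + (M 1 1 : ℂ)) =
    (M 0 0 : ℂ) * z + (M 0 1 : ℂ) := by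
  have h := UpperHalfPlane.coe_specialLinearGroup_apply M z
  have hne : ((M 1 0 : ℂ) * z + (M 1 1 : ℂ)) ≠ 0 := by
    intro h0
    have him := congrArg Complex.im h0
    have hre := congrArg Complex.re h0
    simp at him hre
    have hz := z.im_pos.ne'
    have h10 : M 1 0 = 0 := by
      rcases him with h | h
      · exact h
      · exact absurd h hz
    have h11 : M 1 1 = 0 := by rw [h10] at hre; simpa using hre
    have hdet := M.det_coe
    rw [Matrix.det_fin_two, h10, h11] at hdet
    simp at hdet
  rw [h]
  simp only [Algebra.algebraMap_self, RingHom.id_apply]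
  rw [div_mul_cancel₀ _ hne]

theorem normSq_smul (M : SL2) (z : ℍ) :
    ‖((M • z : ℍ) : ℂ)‖^2 * ((M 1 0)^2 * ‖(z:ℂ)‖^2 + 2 * (M 1 0) * (M 1 1) * z.re + (M 1 1)^2) =
     (M 0 0)^2 * ‖(z:ℂ)‖^2 + 2 * (M 0 0) * (M 0 1) * z.re + (M 0 1)^2 ∧
    0 < (M 1 0)^2 * ‖(z:ℂ)‖^2 + 2 * (M 1 0) * (M 1 1) * z.re + (M 1 1)^2 := by
  have h := congrArg (fun w : ℂ => ‖w‖^2) (coe_out_smul M z)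
  have e : ∀ p q : ℝ, ‖(p:ℂ) * z + q‖^2 = p^2 * ‖(z:ℂ)‖^2 + 2 * p * q * z.re + q^2 := by
    intro p q
    rw [← Complex.normSq_eq_norm_sq, ← Complex.normSq_eq_norm_sq, Complex.normSq_apply, Complex.normSq_apply]
    simp
    ring
  simp only [norm_mul, mul_pow] at h
  rw [e, e] at h
  refine ⟨h, ?_⟩
  have hz := z.im_pos
  have hn : ‖(z:ℂ)‖^2 = z.re^2 + z.im^2 := by
    rw [← Complex.normSq_eq_norm_sq, Complex.normSq_apply]; simp; ring
  rw [hn]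
  by_cases h10 : M 1 0 = 0
  · have hdet := M.det_coe
    rw [Matrix.det_fin_two, h10] at hdet
    have h11 : M 1 1 ≠ 0 := by intro h0; rw [h0] at hdet; simp at hdet
    rw [h10]
    have : 0 < (M 1 1)^2 := by positivity
    linarith
  · have : 0 < (M 1 0)^2 * z.im^2 := by positivity
    nlinarith [sq_nonneg (M 1 0 * z.re + M 1 1)]

theorem exists_pt {c x : ℝ} (hc : 0 < c) (hx : -1 < x) (hx' : x < 1) :
    ∃ z : ℍ, ‖(z:ℂ)‖ = c ∧ z.re = c * x := by
  have h1 : 0 < 1 - x^2 := by nlinarith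
  have hp : 0 < c * Real.sqrt (1 - x^2) := mul_pos hc (Real.sqrt_pos.2 h1)
  refine ⟨⟨⟨c*x, c * Real.sqrt (1 - x^2)⟩, hp⟩, ?_, rfl⟩
  have : ‖(⟨c*x, c * Real.sqrt (1 - x^2)⟩ : ℂ)‖^2 = c^2 := by
    rw [← Complex.normSq_eq_norm_sq, Complex.normSq_apply]
    simp only
    have := Real.mul_self_sqrt h1.le
    linear_combination c^2 * this
  exact (pow_left_inj₀ (norm_nonneg _) hc.le (by norm_num)).1 this

/-- point of the closed geodesic as a symmetric matrix -/
def Xmat (c r : ℝ) : Matrix (Fin 2) (Fin 2) ℝ := !![c^2, c*r; c*r, 1]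

def bf (X Y : Matrix (Fin 2) (Fin 2) ℝ) : ℝ := X 0 0 * Y 1 1 + X 1 1 * Y 0 0 - X 0 1 * Y 0 1 - X 1 0 * Y 1 0

theorem bf_conj (A X Y : Matrix (Fin 2) (Fin 2) ℝ) (hA : A.det = 1) (hX : X 0 1 = X 1 0) (hY : Y 0 1 = Y 1 0) :
    bf (A * X * A.transpose) (A * Y * A.transpose) = bf X Y := by
  have : bf (A * X * A.transpose) (A * Y * A.transpose) = A.det^2 * bf X Y := by
    rw [Matrix.det_fin_two]
    simp only [bf, Matrix.mul_apply, Fin.sum_univ_two, Matrix.transpose_apply, hX, hY]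
    ring
  rw [this, hA]; ring

theorem bf_smul (m : ℝ) (X Y : Matrix (Fin 2) (Fin 2) ℝ) : bf (m • X) Y = m * bf X Y := by
  simp [bf]; ring

theorem bf_smul_right (m : ℝ) (X Y : Matrix (Fin 2) (Fin 2) ℝ) : bf X (m • Y) = m * bf X Y := by
  simp [bf]; ring

theorem endpoint_eq {c : ℝ} (hc : 0 < c) {ξ : OnePoint ℝ} (h : IsEndpoint (circ c) ξ) :
    ∃ r : ℝ, (r = 1 ∨ r = -1) ∧ ξ = ((c * r : ℝ) : OnePoint ℝ) := by
  obtain ⟨γ, -, hr, ht⟩ := h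
  have hmem : ∀ t, ‖(γ t : ℂ)‖ = c := fun t => by
    have : γ t ∈ circ c := hr ▸ Set.mem_range_self t
    exact this
  have hK : IsClosed ((fun z : ℂ => (z : OnePoint ℂ)) '' Metric.sphere (0:ℂ) c) :=
    ((isCompact_sphere (0:ℂ) c).image OnePoint.continuous_coe).isClosed
  have hlim := hK.mem_of_tendsto ht (Filter.Eventually.of_forall fun t =>
    ⟨(γ t : ℂ), by simp [hmem t], rfl⟩)
  obtain ⟨w, hw, hw'⟩ := hlim
  induction ξ using OnePoint.rec with
  | infty => exact absurd hw' (OnePoint.coe_ne_infty w)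
  | coe x =>
    have hw2 : (w : OnePoint ℂ) = ((x : ℂ) : OnePoint ℂ) := hw'
    have hwx : w = (x : ℂ) := OnePoint.coe_injective hw2
    have hx : |x| = c := by simpa [hwx] using hw
    rcases abs_choice x with h | h
    · exact ⟨1, Or.inl rfl, by rw [← hx, h, mul_one]⟩
    · exact ⟨-1, Or.inr rfl, by rw [← hx, h]; simp⟩

theorem crooked_decode {c : ℝ} (hc : 0 < c) {h : PSL2} (hh : h ∈ rightCrooked (circ c)) :
    ∃ A : SL2, (QuotientGroup.mk A : PSL2) = h ∧ ∃ r m : ℝ, -1 ≤ r ∧ r ≤ 1 ∧ 0 ≤ m ∧ m ≤ 1 ∧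
      (A : Matrix (Fin 2) (Fin 2) ℝ) * Xmat c r * (A : Matrix (Fin 2) (Fin 2) ℝ).transpose = m • Xmat c r := by
  rcases hh with ⟨z, hz, hfix⟩ | ⟨ξ, hξ, A, hA, μ, hμ, hfix⟩
  · refine ⟨Quotient.out h, Quotient.out_eq h, z.re / c, 1, ?_, ?_, zero_le_one, le_rfl, ?_⟩
    · have hz' : ‖(z:ℂ)‖ = c := hz
      have := Complex.abs_re_le_norm z
      rw [hz'] at this
      rw [le_div_iff₀ hc]
      have := (abs_le.1 this).1
      simp at this; linarith
    · have hz' : ‖(z:ℂ)‖ = c := hz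
      have := Complex.abs_re_le_norm z
      rw [hz'] at this
      rw [div_le_iff₀ hc]
      have := (abs_le.1 this).2
      simp at this; linarith
    · have hz' : ‖(z:ℂ)‖ = c := hz
      have hn : c^2 = z.re^2 + z.im^2 := by
        rw [← hz', ← Complex.normSq_eq_norm_sq, Complex.normSq_apply]; simp; ring
      have hcr : c * (z.re / c) = z.re := by field_simp
      have hz0 := z.im_pos
      set A : SL2 := Quotient.out h
      have hAz : A • z = z := hfix
      have hm := coe_out_smul A z
      rw [hAz] at hm
      have hre := congrArg Complex.re hm
      have him := congrArg Complex.im hm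
      simp at hre him
      have hdet := A.det_coe
      rw [Matrix.det_fin_two] at hdet
      have e1 : A 0 0 = 2 * A 1 0 * z.re + A 1 1 := by
        have : (2 * A 1 0 * z.re + A 1 1 - A 0 0) * z.im = 0 := by linarith
        rcases mul_eq_zero.1 this with h' | h'
        · linarith
        · exact absurd h' hz0.ne'
      have e2 : A 0 1 = - A 1 0 * (z.re^2 + z.im^2) := by
        rw [e1] at hre; linarith
      have e3 : (A 1 0)^2 * (z.re^2 + z.im^2) + 2 * A 1 0 * A 1 1 * z.re + (A 1 1)^2 = 1 := by
        rw [e1, e2] at hdet; linarith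
      rw [Xmat, hcr, hn, one_smul]
      ext i j
      fin_cases i <;> fin_cases j <;>
        simp [Matrix.mul_apply, Fin.sum_univ_two] <;> rw [← sub_eq_zero]
      · rw [e1, e2]; linear_combination (z.re^2+z.im^2)*e3
      · rw [e1, e2]; linear_combination z.re*e3
      · rw [e1, e2]; linear_combination z.re*e3
      · linear_combination e3
  · obtain ⟨r, hr, rfl⟩ := endpoint_eq hc hξ
    refine ⟨A, hA, r, μ^2, ?_, ?_, sq_nonneg _, ?_, ?_⟩
    · rcases hr with rfl | rfl <;> norm_num
    · rcases hr with rfl | rfl <;> norm_num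
    · rw [← sq_abs]; exact pow_le_one₀ (abs_nonneg _) hμ
    · have hv : bvec ((c*r : ℝ) : OnePoint ℝ) = ![c*r, 1] := rfl
      rw [hv] at hfix
      have f0 := congrFun hfix 0
      have f1 := congrFun hfix 1
      simp [Matrix.mulVec, dotProduct, Fin.sum_univ_two] at f0 f1
      have hX : Xmat c r = !![(c*r)^2, c*r; c*r, 1] := by
        rw [Xmat]; rcases hr with rfl | rfl <;> simp
      rw [hX]
      ext i j
      fin_cases i <;> fin_cases j <;>
        simp [Matrix.mul_apply, Fin.sum_univ_two]
      · linear_combination (A 0 0 * (c*r) + A 0 1 + μ * (c*r)) * f0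
      · linear_combination (A 1 0 * (c*r) + A 1 1) * f0 + μ * (c*r) * f1
      · linear_combination (A 1 0 * (c*r) + A 1 1) * f0 + μ * (c*r) * f1
      · linear_combination (A 1 0 * (c*r) + A 1 1 + μ) * f1

theorem bf_Xmat_expand (R r r' : ℝ) (hR : 0 < R) (K : Matrix (Fin 2) (Fin 2) ℝ) :
    bf (Xmat (1/R) r) (K * Xmat R r' * K.transpose) =
      (1+r)/2*((1+r')/2)*((1/R)*(K 1 0*1*R+K 1 1) - (K 0 0*1*R+K 0 1))^2 +
      (1+r)/2*((1-r')/2)*((1/R)*(K 1 0*(-1)*R+K 1 1) - (K 0 0*(-1)*R+K 0 1))^2 +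
      (1-r)/2*((1+r')/2)*((-1/R)*(K 1 0*1*R+K 1 1) - (K 0 0*1*R+K 0 1))^2 +
      (1-r)/2*((1-r')/2)*((-1/R)*(K 1 0*(-1)*R+K 1 1) - (K 0 0*(-1)*R+K 0 1))^2 := by
  simp [bf, Xmat, Matrix.mul_apply, Fin.sum_univ_two]
  field_simp
  ring

theorem bf_lt {R r r' : ℝ} (hR : 0 < R) (hr : -1 ≤ r) (hr1 : r ≤ 1) (hr' : -1 ≤ r') (hr1' : r' ≤ 1)
    (K : Matrix (Fin 2) (Fin 2) ℝ)
    (H : ∀ e e' : ℝ, (e = 1 ∨ e = -1) → (e' = 1 ∨ e' = -1) →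
      ((e/R)*(K 1 0*e'*R+K 1 1) - (K 0 0*e'*R+K 0 1))^2 < (e/R - e'*R)^2) :
    0 ≤ bf (Xmat (1/R) r) (K * Xmat R r' * K.transpose) ∧
    bf (Xmat (1/R) r) (K * Xmat R r' * K.transpose) < bf (Xmat (1/R) r) (Xmat R r') := by
  have E1 := bf_Xmat_expand R r r' hR K
  have E2 := bf_Xmat_expand R r r' hR 1
  simp only [Matrix.one_mul, Matrix.transpose_one, Matrix.mul_one, Matrix.one_apply_eq,
    Matrix.one_apply_ne (show (1 : Fin 2) ≠ 0 by decide),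
    Matrix.one_apply_ne (show (0 : Fin 2) ≠ 1 by decide)] at E2
  have a1 := H 1 1 (Or.inl rfl) (Or.inl rfl)
  have a2 := H 1 (-1) (Or.inl rfl) (Or.inr rfl)
  have a3 := H (-1) 1 (Or.inr rfl) (Or.inl rfl)
  have a4 := H (-1) (-1) (Or.inr rfl) (Or.inr rfl)
  rw [E1, E2]
  set D1 := ((1/R)*(K 1 0*1*R+K 1 1) - (K 0 0*1*R+K 0 1))^2 with hD1
  set D2 := ((1/R)*(K 1 0*(-1)*R+K 1 1) - (K 0 0*(-1)*R+K 0 1))^2 with hD2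
  set D3 := ((-1/R)*(K 1 0*1*R+K 1 1) - (K 0 0*1*R+K 0 1))^2 with hD3
  set D4 := ((-1/R)*(K 1 0*(-1)*R+K 1 1) - (K 0 0*(-1)*R+K 0 1))^2 with hD4
  have p1 : 0 ≤ (1+r)/2 := by linarith
  have p2 : 0 ≤ (1-r)/2 := by linarith
  have p3 : 0 ≤ (1+r')/2 := by linarith
  have p4 : 0 ≤ (1-r')/2 := by linarith
  have p5 : (1+r)/2 + (1-r)/2 = 1 := by ring
  have p6 : (1+r')/2 + (1-r')/2 = 1 := by ring
  constructor
  · positivity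
  · generalize (1+r)/2 = x at *
    generalize (1-r)/2 = y at *
    generalize (1+r')/2 = x' at *
    generalize (1-r')/2 = y' at *
    have z1 : ∀ e e' : ℝ, e/R*(0*e'*R+1) - (1*e'*R+0) = e/R - e'*R := by intros; ring
    simp only [z1]
    have m1 := mul_nonneg p1 p3
    have m2 := mul_nonneg p1 p4
    have m3 := mul_nonneg p2 p3
    have m4 := mul_nonneg p2 p4
    have msum : x*x' + x*y' + y*x' + y*y' = 1 := by
      have : (x+y)*(x'+y') = 1 := by rw [p5, p6, one_mul]
      linarith
    generalize x*x' = n1 at *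
    generalize x*y' = n2 at *
    generalize y*x' = n3 at *
    generalize y*y' = n4 at *
    have l1 := mul_le_mul_of_nonneg_left a1.le m1
    have l2 := mul_le_mul_of_nonneg_left a2.le m2
    have l3 := mul_le_mul_of_nonneg_left a3.le m3
    have l4 := mul_le_mul_of_nonneg_left a4.le m4
    rcases lt_or_eq_of_le m1 with q1 | q1
    · have := mul_lt_mul_of_pos_left a1 q1; linarith
    rcases lt_or_eq_of_le m2 with q2 | q2
    · have := mul_lt_mul_of_pos_left a2 q2; linarith
    rcases lt_or_eq_of_le m3 with q3 | q3
    · have := mul_lt_mul_of_pos_left a3 q3; linarith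
    have q4 : 0 < n4 := by linarith
    have := mul_lt_mul_of_pos_left a4 q4; linarith

theorem pos_of_norm (K : SL2) {R : ℝ} (hR : 0 < R) (h : ∀ z : ℍ, ‖(z:ℂ)‖ = R → 1/R < ‖((K • z : ℍ):ℂ)‖)
    (x : ℝ) (hx : -1 < x) (hx' : x < 1) :
    0 < R^2*((K 0 0)^2*R^2+(K 0 1)^2+2*(K 0 0)*(K 0 1)*R*x) -
      ((K 1 0)^2*R^2+(K 1 1)^2+2*(K 1 0)*(K 1 1)*R*x) := by
  obtain ⟨z, hz, hzr⟩ := exists_pt hR hx hx'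
  have h1 := h z hz
  obtain ⟨h2, h3⟩ := normSq_smul K z
  rw [hz, hzr] at h2 h3
  have h4 : 1 < R^2*‖((K • z : ℍ):ℂ)‖^2 := by
    rw [div_lt_iff₀ hR] at h1
    nlinarith
  have h5 := mul_lt_mul_of_pos_right h4 h3
  have h6 := congrArg (fun w => R^2 * w) h2

  linarith [h6, h5]

theorem pos_of_norm_inv (K : SL2) {R : ℝ} (hR : 0 < R)
    (h : ∀ z : ℍ, ‖(z:ℂ)‖ = 1/R → ‖((K⁻¹ • z : ℍ):ℂ)‖ < R)
    (x : ℝ) (hx : -1 < x) (hx' : x < 1) :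
    0 < R^2*((K 1 0)^2+(K 0 0)^2*R^2-2*(K 1 0)*(K 0 0)*R*x) -
      ((K 1 1)^2+(K 0 1)^2*R^2-2*(K 1 1)*(K 0 1)*R*x) := by
  obtain ⟨z, hz, hzr⟩ := exists_pt (one_div_pos.2 hR) hx hx'
  have h1 := h z hz
  obtain ⟨h2, h3⟩ := normSq_smul K⁻¹ z
  rw [hz, hzr] at h2 h3
  have h4 : ‖((K⁻¹ • z : ℍ):ℂ)‖^2 < R^2 := by
    have := norm_nonneg ((K⁻¹ • z : ℍ):ℂ)
    nlinarith
  have h5 := mul_lt_mul_of_pos_right h4 h3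
  rw [h2] at h5
  simp only [Matrix.SpecialLinearGroup.SL2_inv_expl, Matrix.of_apply, Matrix.cons_val', Matrix.cons_val_zero,
    Matrix.cons_val_one, Matrix.cons_val_fin_one] at h5
  have h6 := mul_lt_mul_of_pos_left h5 (by positivity : 0 < R^2)
  have r1 : ∀ p q : ℝ, R^2 * (p^2 * (1/R)^2 + 2*p*q*(1/R*x) + q^2) = p^2 + 2*p*q*R*x + q^2*R^2 := by
    intro p q; field_simp
  rw [r1, r1] at h6
  linarith

theorem stmt16 (R : ℝ) (hR : 1 < R) (g g' : PSL2)
    (hSQ : g⁻¹ * g' ∈ SQell R * SQell'inv R)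
    (h1 : pslImg g (circ (1 / R)) ∩ pslImg g' (circ R) = ∅)
    (h2 : pslImg g {z : ℍ | ‖(z : ℂ)‖ < 1 / R} ∩ pslImg g' (circ R) = ∅)
    (h3 : pslImg g' {z : ℍ | R < ‖(z : ℂ)‖} ∩ pslImg g (circ (1 / R)) = ∅) :
    Disjoint ((g * ·) '' rightCrooked (circ (1 / R)))
      ((g' * ·) '' rightCrooked (circ R)) := by
  have hR0 : 0 < R := by linarith
  set G : SL2 := Quotient.out g with hG
  set G' : SL2 := Quotient.out g' with hG'
  have hg : (QuotientGroup.mk G : PSL2) = g := Quotient.out_eq g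
  have hg' : (QuotientGroup.mk G' : PSL2) = g' := Quotient.out_eq g'
  set K : SL2 := G⁻¹ * G' with hK
  have hKmk : (QuotientGroup.mk K : PSL2) = g⁻¹ * g' := by
    rw [hK, ← hg, ← hg']; rfl
  have N1 : ∀ z : ℍ, ‖(z:ℂ)‖ = R → 1/R < ‖((K • z : ℍ):ℂ)‖ := by
    intro z hz
    by_contra hc
    push Not at hc
    have hmem : G • (K • z) = G' • z := by rw [hK, smul_smul]; simp
    have hR' : G' • z ∈ pslImg g' (circ R) := ⟨z, hz, rfl⟩
    rcases lt_or_eq_of_le hc with h | h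
    · exact Set.eq_empty_iff_forall_notMem.1 h2 (G' • z) ⟨⟨K • z, h, hmem⟩, hR'⟩
    · exact Set.eq_empty_iff_forall_notMem.1 h1 (G' • z) ⟨⟨K • z, h, hmem⟩, hR'⟩
  have N2 : ∀ z : ℍ, ‖(z:ℂ)‖ = 1/R → ‖((K⁻¹ • z : ℍ):ℂ)‖ < R := by
    intro z hz
    by_contra hc
    push Not at hc
    have hmem : G' • (K⁻¹ • z) = G • z := by rw [hK, smul_smul]; simp
    have hR' : G • z ∈ pslImg g (circ (1/R)) := ⟨z, hz, rfl⟩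
    rcases lt_or_eq_of_le hc with h | h
    · exact Set.eq_empty_iff_forall_notMem.1 h3 (G • z) ⟨⟨K⁻¹ • z, h, hmem⟩, hR'⟩
    · exact Set.eq_empty_iff_forall_notMem.1 h1 (G • z) ⟨hR', ⟨K⁻¹ • z, h.symm, hmem⟩⟩
  have H1 := pos_of_norm K hR0 N1
  have H2 := pos_of_norm_inv K hR0 N2
  obtain ⟨q, ⟨Q, α, β, v, hQ, hQe, hQ1, hQ2⟩, p, ⟨P, α', β', v', hP, hPe, hP1, hP2⟩, hqp⟩ := hSQ
  have hmk : (QuotientGroup.mk (Q * P) : PSL2) = QuotientGroup.mk K := by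
    rw [hKmk, ← hqp, ← hQ, ← hP]; rfl
  clear_value K
  obtain ⟨σ, hσ, hKe⟩ := mk_eq_sign hmk
  rw [Matrix.SpecialLinearGroup.coe_mul, hQe, hPe] at hKe
  have dQ := Q.det_coe
  rw [hQe, Matrix.det_fin_two] at dQ
  have dP := P.det_coe
  rw [hPe, Matrix.det_fin_two] at dP
  have hRn : R ≠ 0 := hR0.ne'
  have D := core hR hσ (α := α) (β := β) (v := v) (α' := α') (β' := β') (v' := v')
    (k1 := K 0 0) (k2 := K 0 1) (k3 := K 1 0) (k4 := K 1 1)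
    (by simp at dQ; field_simp at dQ; linarith) hQ1 hQ2
    (by simp at dP; field_simp at dP; linarith) hP1 hP2
    (by rw [hKe]; simp [Matrix.mul_apply, Fin.sum_univ_two]; left; field_simp)
    (by rw [hKe]; simp [Matrix.mul_apply, Fin.sum_univ_two]; left; field_simp; ring)
    (by rw [hKe]; simp [Matrix.mul_apply, Fin.sum_univ_two]; left; field_simp; ring)
    (by rw [hKe]; simp [Matrix.mul_apply, Fin.sum_univ_two]; left; field_simp)
    H1 H2
  rw [Set.disjoint_left]
  rintro _ ⟨a, ha, rfl⟩ ⟨b, hb, hab⟩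
  obtain ⟨A, hA, r, m, hr, hr1, hm, hm1, hAX⟩ := crooked_decode (one_div_pos.2 hR0) ha
  obtain ⟨B, hB, r', m', hr', hr1', hm', hm1', hBX⟩ := crooked_decode hR0 hb
  have hAB : (QuotientGroup.mk (K * B) : PSL2) = QuotientGroup.mk A := by
    have : (QuotientGroup.mk (K * B) : PSL2) = QuotientGroup.mk K * QuotientGroup.mk B := rfl
    have hab' : g' * b = g * a := hab
    rw [this, hKmk, hA, hB, mul_assoc, hab', inv_mul_cancel_left]
  obtain ⟨s, hs, hsA⟩ := mk_eq_sign hAB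
  rw [Matrix.SpecialLinearGroup.coe_mul] at hsA
  have hss : s * s = 1 := by rcases hs with rfl | rfl <;> norm_num
  obtain ⟨F0, F1⟩ := bf_lt hR0 hr hr1 hr' hr1' (K : Matrix (Fin 2) (Fin 2) ℝ) D
  have hinv := bf_conj (A : Matrix (Fin 2) (Fin 2) ℝ) (Xmat (1/R) r) (Xmat R r') A.det_coe rfl rfl
  have hAX' : (A : Matrix (Fin 2) (Fin 2) ℝ) * Xmat R r' * (A : Matrix (Fin 2) (Fin 2) ℝ).transpose
      = m' • ((K : Matrix (Fin 2) (Fin 2) ℝ) * Xmat R r' * (K : Matrix (Fin 2) (Fin 2) ℝ).transpose) := by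
    rw [hsA, Matrix.transpose_smul, Matrix.transpose_mul, Matrix.smul_mul, Matrix.smul_mul,
      Matrix.mul_smul, smul_smul, hss, one_smul]
    calc _ = (K : Matrix (Fin 2) (Fin 2) ℝ) * ((B : Matrix (Fin 2) (Fin 2) ℝ) * Xmat R r' *
          (B : Matrix (Fin 2) (Fin 2) ℝ).transpose) * (K : Matrix (Fin 2) (Fin 2) ℝ).transpose := by
          simp only [Matrix.mul_assoc]
      _ = _ := by rw [hBX, Matrix.mul_smul, Matrix.smul_mul]
  rw [hAX, hAX', bf_smul, bf_smul_right] at hinv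
  have : m * (m' * bf (Xmat (1/R) r) ((K : Matrix (Fin 2) (Fin 2) ℝ) * Xmat R r' * (K : Matrix (Fin 2) (Fin 2) ℝ).transpose))
      ≤ bf (Xmat (1/R) r) ((K : Matrix (Fin 2) (Fin 2) ℝ) * Xmat R r' * (K : Matrix (Fin 2) (Fin 2) ℝ).transpose) := by
    rw [← mul_assoc]
    exact mul_le_of_le_one_left F0 (mul_le_one₀ hm1 hm' hm1')
  linarith

end
end

section
/- Fix R > 1. Let h ∈ PSL(2,ℝ) have a lift [[a,b],[c,d]] ∈ SL(2,ℝ) (so ad − bc = 1) with (b,c) ≠ (0,0), and suppose that |aR + ε'b + εc + εε'd/R| < R + εε'/R for all ε, ε' ∈ {1,−1}. Then there exist ε ∈ {1,−1} and t > 0 such that h·P'_ε(t) ∈ SQ(ℓ), or there exist ε ∈ {1,−1} and t > 0 such that P_ε(t)⁻¹·h ∈ SQ(ℓ')⁻¹. -/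
noncomputable section

open Filter Topology Pointwise
open scoped UpperHalfPlane

variable {Γ : Type*} [Group Γ]

theorem core17 (R a b c d e t : ℝ) (hR : 1 < R) (hdet : a * d - b * c = 1)
    (he : e = 1 ∨ e = -1)
    (hineq : ∀ ε ε' : ℝ, (ε = 1 ∨ ε = -1) → (ε' = 1 ∨ ε' = -1) →
      |a * R + ε' * b + ε * c + ε * ε' * d / R| < R + ε * ε' / R)
    (hD : e * (R ^ 3 * a - d / R) + (R ^ 2 * b - c) ≠ 0)
    (ht : t * (e * (R ^ 3 * a - d / R) + (R ^ 2 * b - c)) = R ^ 2 * b + c) :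
    ∃ α β v : ℝ, a * (1 + t) + b * (e * t / R) = α ∧
      a * (-e * R * t) + b * (1 - t) = -v / R ∧
      c * (1 + t) + d * (e * t / R) = v * R ∧
      c * (-e * R * t) + d * (1 - t) = β ∧ |α| < |β| ∧ 2 * |v| < |α - β| := by
  have hR0 : 0 < R := by linarith
  have hRne : R ≠ 0 := hR0.ne'
  have hee : e * e = 1 := by rcases he with rfl | rfl <;> norm_num
  obtain ⟨s, hs⟩ : ∃ s : ℝ, s = 1 / R := ⟨_, rfl⟩
  have hRs : R * s = 1 := by rw [hs]; field_simp
  have hs0 : 0 < s := by rw [hs]; positivity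
  have hdiv : ∀ x : ℝ, x / R = x * s := fun x => by rw [hs]; ring
  simp only [hdiv] at *
  have hne : -e = 1 ∨ -e = -1 := by rcases he with rfl | rfl <;> norm_num
  have h1 := hineq e e he he
  have h2 := hineq (-e) e hne he
  rw [abs_lt] at h1 h2
  obtain ⟨X, hX⟩ : ∃ X, X = a * R + e * b := ⟨_, rfl⟩
  obtain ⟨y, hy⟩ : ∃ y, y = e * c + d * s := ⟨_, rfl⟩
  have h1a : X + y < R + s := by
    have := h1.2; rw [hee] at this; linarith
  have h1b : -(R + s) < X + y := by
    have := h1.1; rw [hee] at this; linarith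
  have hm : -e * e = -1 := by linarith
  have h2a : X - y < R - s := by
    have := h2.2; rw [hm] at this; linarith
  have h2b : -(R - s) < X - y := by
    have := h2.1; rw [hm] at this; linarith
  obtain ⟨E, hE⟩ : ∃ E, E = R ^ 2 * X - y := ⟨_, rfl⟩
  have hED : e * (R ^ 3 * a - d * s) + (R ^ 2 * b - c) = e * E := by
    rw [hE, hX, hy]; linear_combination (-R ^ 2 * b + c) * hee
  rw [hED] at hD ht
  have hE0 : E ≠ 0 := right_ne_zero_of_mul hD
  have htE : t * E = e * (R ^ 2 * b + c) := by linear_combination e * ht - t * E * hee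
  obtain ⟨α, hα⟩ : ∃ α, α = a * (1 + t) + b * (e * t * s) := ⟨_, rfl⟩
  obtain ⟨β, hβ⟩ : ∃ β, β = c * (-e * R * t) + d * (1 - t) := ⟨_, rfl⟩
  obtain ⟨v, hv⟩ : ∃ v, v = (c * (1 + t) + d * (e * t * s)) * s := ⟨_, rfl⟩
  have hvR : c * (1 + t) + d * (e * t * s) = v * R := by
    rw [hv]; linear_combination -(c * (1 + t) + d * (e * t * s)) * hRs
  have hvs : a * (-e * R * t) + b * (1 - t) = -v * s := by
    have hk : R ^ 2 * (a * (-e * R * t) + b * (1 - t)) = -(c * (1 + t) + d * (e * t * s)) := by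
      rw [hE, hX, hy] at ht
      linear_combination -ht + t * (R ^ 2 * b - c) * hee
    have : a * (-e * R * t) + b * (1 - t) = s ^ 2 * (R ^ 2 * (a * (-e * R * t) + b * (1 - t))) := by
      linear_combination -(a * (-e * R * t) + b * (1 - t)) * (R * s + 1) * hRs
    rw [this, hk, hv]; ring
  have hd1 : α * β + v ^ 2 = 1 := by
    have h3 : α * β - (-v * s) * (v * R) = 1 := by
      rw [← hvs, ← hvR, hα, hβ]
      linear_combination (1 + t) * (1 - t) * hdet + e * e * t ^ 2 * R * s * hdet + e * e * t ^ 2 * hRs + t ^ 2 * hee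
    linear_combination h3 - v ^ 2 * hRs
  have hαE : α * E = R * X ^ 2 - s := by
    have : α * E = a * E + (a + b * e * s) * (t * E) := by rw [hα]; ring
    rw [this, htE, hE, hX, hy]
    rcases he with rfl | rfl
    · linear_combination (-s) * hdet + (b ^ 2 * R) * hRs
    · linear_combination (-s) * hdet + (b ^ 2 * R) * hRs
  have hβE : β * E = R * (R ^ 2 - y ^ 2) := by
    have : β * E = d * E - (c * e * R + d) * (t * E) := by rw [hβ]; ring
    rw [this, htE, hE, hX, hy]
    rcases he with rfl | rfl
    · linear_combination R ^ 3 * hdet + (d ^ 2 * s + 2 * c * d) * hRs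
    · linear_combination R ^ 3 * hdet + (d ^ 2 * s - 2 * c * d) * hRs
  refine ⟨α, β, v, hα.symm, hvs, hvR, hβ.symm, ?_⟩
  have hEE : 0 < E ^ 2 := by positivity
  have hdiff : 0 < (β - α) * E := by
    have : (β - α) * E = R * (R ^ 2 + s ^ 2 - X ^ 2 - y ^ 2) := by
      linear_combination hβE - hαE - s * hRs
    rw [this]
    have g1 : 0 < (R + s - (X + y)) * (R + s + (X + y)) := mul_pos (by linarith) (by linarith)
    have g2 : 0 < (R - s - (X - y)) * (R - s + (X - y)) := mul_pos (by linarith) (by linarith)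
    apply mul_pos hR0; linarith
  have hp : 0 < (α + β) * E - 2 * E := by
    have : (α + β) * E - 2 * E = R * ((R + s - (X + y)) * (R - s - (X - y))) := by
      linear_combination hβE + hαE - 2 * hE + (s - 2 * y) * hRs
    rw [this]
    exact mul_pos hR0 (mul_pos (by linarith) (by linarith))
  have hq : 0 < (α + β) * E + 2 * E := by
    have : (α + β) * E + 2 * E = R * ((R + s + (X + y)) * (R - s + (X - y))) := by
      linear_combination hβE + hαE + 2 * hE + (s + 2 * y) * hRs
    rw [this]
    exact mul_pos hR0 (mul_pos (by linarith) (by linarith))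
  have hsum : 0 < (α + β) * E := by linarith
  constructor
  · rw [← sq_lt_sq]
    have : 0 < (β ^ 2 - α ^ 2) * E ^ 2 := by
      have := mul_pos hdiff hsum
      ring_nf at this ⊢; linarith
    have := pos_of_mul_pos_left this hEE.le
    linarith
  · have h4 : 0 < ((α + β) ^ 2 - 4) * E ^ 2 := by
      have := mul_pos hp hq
      ring_nf at this ⊢; linarith
    have h5 := pos_of_mul_pos_left h4 hEE.le
    have : |2 * v| < |α - β| := by
      rw [← sq_lt_sq]; linarith [hd1, h5]
    rwa [abs_mul, abs_two] at this

theorem signs17 (R S b c : ℝ) (hR : 1 < R) (hbc : ¬ (b = 0 ∧ c = 0)) :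
    (∃ ε : ℝ, (ε = 1 ∨ ε = -1) ∧ 0 < (R ^ 2 * b + c) * (ε * S + (R ^ 2 * b - c))) ∨
    (∃ ε : ℝ, (ε = 1 ∨ ε = -1) ∧ 0 < (R ^ 2 * c + b) * (ε * S + (R ^ 2 * c - b))) := by
  by_contra hcon
  push Not at hcon
  obtain ⟨h1, h2⟩ := hcon
  have a1 := h1 1 (Or.inl rfl)
  have a2 := h1 (-1) (Or.inr rfl)
  have b1 := h2 1 (Or.inl rfl)
  have b2 := h2 (-1) (Or.inr rfl)
  have h4 : 0 < R ^ 4 - 1 := by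
    have := one_lt_pow₀ hR (n := 4) (by norm_num)
    linarith
  have h5 : (R ^ 4 - 1) * (b ^ 2 + c ^ 2) ≤ 0 := by nlinarith
  have h6 : b ^ 2 + c ^ 2 ≤ 0 := by
    by_contra h; push Not at h; exact absurd (mul_pos h4 h) (not_lt.2 h5)
  exact hbc ⟨by nlinarith [sq_nonneg b, sq_nonneg c], by nlinarith [sq_nonneg b, sq_nonneg c]⟩

theorem stmt17 (R : ℝ) (hR : 1 < R)
    (P P' : ℝ → ℝ → PSL2)
    (hP : ∀ ε : ℝ, (ε = 1 ∨ ε = -1) → ∀ t : ℝ,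
      ∃ A : SL2, (QuotientGroup.mk A : PSL2) = P ε t ∧
        (A : Matrix (Fin 2) (Fin 2) ℝ) = !![1 - t, -ε * t / R; ε * R * t, 1 + t])
    (hP' : ∀ ε : ℝ, (ε = 1 ∨ ε = -1) → ∀ t : ℝ,
      ∃ A : SL2, (QuotientGroup.mk A : PSL2) = P' ε t ∧
        (A : Matrix (Fin 2) (Fin 2) ℝ) = !![1 + t, -ε * R * t; ε * t / R, 1 - t])
    (h : PSL2) (a b c d : ℝ)
    (hlift : ∃ A : SL2, (QuotientGroup.mk A : PSL2) = h ∧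
      (A : Matrix (Fin 2) (Fin 2) ℝ) = !![a, b; c, d])
    (hbc : (b, c) ≠ ((0 : ℝ), (0 : ℝ)))
    (hineq : ∀ ε ε' : ℝ, (ε = 1 ∨ ε = -1) → (ε' = 1 ∨ ε' = -1) →
      |a * R + ε' * b + ε * c + ε * ε' * d / R| < R + ε * ε' / R) :
    (∃ ε : ℝ, (ε = 1 ∨ ε = -1) ∧ ∃ t > 0, h * P' ε t ∈ SQell R) ∨
    (∃ ε : ℝ, (ε = 1 ∨ ε = -1) ∧ ∃ t > 0, (P ε t)⁻¹ * h ∈ SQell'inv R) := by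
  obtain ⟨A, hA, hAm⟩ := hlift
  have hdet : a * d - b * c = 1 := by
    have := A.det_coe
    rwa [hAm, Matrix.det_fin_two_of] at this
  have hbc' : ¬ (b = 0 ∧ c = 0) := fun h => hbc (by rw [h.1, h.2])
  rcases signs17 R (R ^ 3 * a - d / R) b c hR hbc' with ⟨e, he, hpos⟩ | ⟨e, he, hpos⟩
  · left
    have hD := right_ne_zero_of_mul hpos.ne'
    refine ⟨e, he, (R ^ 2 * b + c) / (e * (R ^ 3 * a - d / R) + (R ^ 2 * b - c)), ?_, ?_⟩
    · exact div_pos_iff.2 (mul_pos_iff.1 hpos)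
    · generalize ht : (R ^ 2 * b + c) / (e * (R ^ 3 * a - d / R) + (R ^ 2 * b - c)) = t
      have ht' := ((div_eq_iff hD).1 ht).symm
      obtain ⟨α, β, v, e1, e2, e3, e4, l1, l2⟩ :=
        core17 R a b c d e t hR hdet he hineq hD ht'
      obtain ⟨B, hB, hBm⟩ := hP' e he t
      refine ⟨A * B, α, β, v, ?_, ?_, l1, l2⟩
      · rw [QuotientGroup.mk_mul, hA, hB]
      · rw [Matrix.SpecialLinearGroup.coe_mul, hAm, hBm, Matrix.mul_fin_two, e1, e2, e3, e4]
  · right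
    have hD := right_ne_zero_of_mul hpos.ne'
    refine ⟨e, he, (R ^ 2 * c + b) / (e * (R ^ 3 * a - d / R) + (R ^ 2 * c - b)), ?_, ?_⟩
    · exact div_pos_iff.2 (mul_pos_iff.1 hpos)
    · generalize ht : (R ^ 2 * c + b) / (e * (R ^ 3 * a - d / R) + (R ^ 2 * c - b)) = t
      have ht' := ((div_eq_iff hD).1 ht).symm
      have hineq' : ∀ ε ε' : ℝ, (ε = 1 ∨ ε = -1) → (ε' = 1 ∨ ε' = -1) →
          |a * R + ε' * c + ε * b + ε * ε' * d / R| < R + ε * ε' / R := by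
        intro ε ε' h1 h2
        have := hineq ε' ε h2 h1
        rw [mul_comm ε' ε] at this
        rwa [add_right_comm (a * R)] at this
      obtain ⟨α, β, v, e1, e2, e3, e4, l1, l2⟩ :=
        core17 R a c b d e t hR (by linarith) he hineq' hD ht'
      obtain ⟨B, hB, hBm⟩ := hP e he t
      refine ⟨B⁻¹ * A, α, β, v, ?_, ?_, l1, l2⟩
      · rw [QuotientGroup.mk_mul, QuotientGroup.mk_inv, hA, hB]
      · rw [Matrix.SpecialLinearGroup.coe_mul, Matrix.SpecialLinearGroup.coe_inv, hAm, hBm,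
          Matrix.adjugate_fin_two_of, Matrix.mul_fin_two, ← e1, ← e2, ← e3, ← e4]
        ext i j
        fin_cases i <;> fin_cases j <;> simp <;> ring

end
end

section
/- Fix R > 1 and let ℓ = {z ∈ ℍ : |z| = 1/R} and ℓ' = {z ∈ ℍ : |z| = R}. Let h ∈ PSL(2,ℝ) satisfy: sup over x ∈ ℓ, x' ∈ ℓ' of d(x, h·x') − d(x, x') is strictly negative; the closures of ℓ and h·ℓ' in the one-point compactification of ℂ are disjoint; h·ℓ' ⊆ {z ∈ ℍ : |z| > 1/R}; and h⁻¹·ℓ ⊆ {z ∈ ℍ : |z| < R}. Then exactly one of the following three alternatives holds: h ∈ SQ(ℓ); there exists t > 0 with h·P'₁(t) ∈ SQ(ℓ); there exists t > 0 with h·P'₋₁(t) ∈ SQ(ℓ). Likewise, exactly one of the following three alternatives holds: h ∈ SQ(ℓ')⁻¹; there exists t > 0 with P₁(t)⁻¹·h ∈ SQ(ℓ')⁻¹; there exists t > 0 with P₋₁(t)⁻¹·h ∈ SQ(ℓ')⁻¹. -/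
noncomputable section

open Filter Topology Pointwise
open scoped UpperHalfPlane

variable {Γ : Type*} [Group Γ]

/-- scaled quadrant lemma -/
lemma aux_L {k S T U W : ℝ} (hk0 : 0 < k) (hk1 : k < 1) (hS : 0 < S) (hT : 0 < T) (hU : 0 < U)
    (hW : 0 < W) (hS1 : S < 1) (hW1 : W < 1) (e1 : 1 - U * W = k * (1 - S * T))
    (e2 : U - W = k * (S - T)) : S < U ∧ T < W := by
  constructor
  · by_contra hc
    push Not at hc
    have h1 : (1 - U ^ 2) - k * (1 - U * S) + k * T * (S - U) = 0 := by
      have : W = U - k * (S - T) := by linarith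
      subst this; linarith
    have h2 : U * U ≤ U * S := mul_le_mul_of_nonneg_left hc hU.le
    have h3 : U * S < 1 := by nlinarith
    have h4 : 0 < (1 - k) * (1 - U * S) := mul_pos (by linarith) (by linarith)
    have h5 : 0 ≤ k * T * (S - U) := mul_nonneg (mul_pos hk0 hT).le (by linarith)
    nlinarith
  · by_contra hc
    push Not at hc
    have h1 : (1 - W ^ 2) - k * (1 - W * T) + k * S * (T - W) = 0 := by
      have : U = W + k * (S - T) := by linarith
      subst this; linarith
    have h2 : W * W ≤ W * T := mul_le_mul_of_nonneg_left hc hW.le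
    have h3 : W * W < 1 := by nlinarith
    have h4 : 0 < (1 - k) * (1 - W * W) := mul_pos (by linarith) (by linarith)
    have h5 : 0 ≤ k * S * (T - W) := mul_nonneg (mul_pos hk0 hS).le (by linarith)
    have h6 : 0 ≤ k * (W * T - W * W) := mul_nonneg hk0.le (by linarith)
    nlinarith

lemma aux_K {q s t u w : ℝ} (hq0 : 0 < q) (hq1 : q < 1) (hs : 0 < s) (ht : 0 < t) (hu : 0 < u)
    (hw : 0 < w) (hs1 : s < 1 - q) (hw1 : w < 1 + q) (e1 : u * w - s * t = 4 * q)
    (e2 : (1 + q) * (u - w) = (1 - q) * (s - t)) :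
    s * (1 + q) < u * (1 - q) ∧ t * (1 + q) < w * (1 - q) := by
  have hm : 0 < 1 - q := by linarith
  have hn : 0 < 1 + q := by linarith
  have := @aux_L ((1 - q) ^ 2 / (1 + q) ^ 2) (s / (1 - q)) (t / (1 - q)) (u / (1 + q)) (w / (1 + q))
    (by positivity) (by rw [div_lt_one (by positivity)]; nlinarith) (by positivity) (by positivity)
    (by positivity) (by positivity) (by rwa [div_lt_one hm]) (by rwa [div_lt_one hn])
    (by field_simp; nlinarith) (by field_simp; nlinarith)
  rwa [div_lt_div_iff₀ hm hn, div_lt_div_iff₀ hm hn] at this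

def Qc (q a C D E : ℝ) : Prop := E + q * C = 0 ∧ q * |a| < |D| ∧ 2 * q * |C| < |q * a - D|

lemma aux_Q {q a C D E : ℝ} (hq0 : 0 < q) (hq1 : q < 1) (hdet : a * D - C * E = q)
    (hs : 0 < a + E - C - D) (ht : 0 < a + C - D - E) (hu : 0 < a + D - C - E)
    (hw : 0 < a + C + D + E)
    (hb : (a + E - C - D < 1 - q ∧ a + C + D + E < 1 + q) ∨
      (a + C - D - E < 1 - q ∧ a + D - C - E < 1 + q))
    (hE : E + q * C = 0) : Qc q a C D E := by
  have key : (a + E - C - D) * (1 + q) < (a + D - C - E) * (1 - q) ∧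
      (a + C - D - E) * (1 + q) < (a + C + D + E) * (1 - q) := by
    rcases hb with hb | hb
    · exact aux_K hq0 hq1 hs ht hu hw hb.1 hb.2 (by nlinarith) (by linarith)
    · exact (aux_K hq0 hq1 ht hs hw hu hb.1 hb.2 (by nlinarith) (by linarith)).symm
  have ha : 0 < a := by linarith
  have h1 : 0 < D - q * a + 2 * q * C := by linarith [key.1]
  have h2 : 0 < D - q * a - 2 * q * C := by linarith [key.2]
  have hqa : 0 < q * a := mul_pos hq0 ha
  refine ⟨hE, ?_, ?_⟩
  · rw [abs_of_pos ha, abs_of_pos (by linarith)]; linarith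
  · rw [abs_of_neg (show q * a - D < 0 by linarith)]
    have : 2 * q * |C| = |2 * q * C| := by
      rw [abs_mul, abs_of_pos (by positivity : (0:ℝ) < 2 * q)]
    rw [this, abs_lt]; constructor <;> linarith

def Qt (q a C D E ε t : ℝ) : Prop :=
  Qc q (a * (1 + t) + E * ε * t) (C * (1 + t) + D * ε * t) (D * (1 - t) - C * ε * t)
    (E * (1 - t) - a * ε * t)

lemma core_s18 {q a C D E : ℝ} (hq0 : 0 < q) (hq1 : q < 1) (hdet : a * D - C * E = q)
    (hs : 0 < a + E - C - D) (ht : 0 < a + C - D - E) (hu : 0 < a + D - C - E)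
    (hw : 0 < a + C + D + E)
    (hs1 : a + E - C - D < 1 - q) (hw1 : a + C + D + E < 1 + q)
    (ht1 : a + C - D - E < 1 - q) (hu1 : a + D - C - E < 1 + q) :
    (Qc q a C D E ∧ ¬ (∃ t > 0, Qt q a C D E 1 t) ∧ ¬ (∃ t > 0, Qt q a C D E (-1) t)) ∨
    (¬ Qc q a C D E ∧ (∃ t > 0, Qt q a C D E 1 t) ∧ ¬ (∃ t > 0, Qt q a C D E (-1) t)) ∨
    (¬ Qc q a C D E ∧ ¬ (∃ t > 0, Qt q a C D E 1 t) ∧ (∃ t > 0, Qt q a C D E (-1) t)) := by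
  have p1 : 0 < a - q * D + (q * C - E) := by nlinarith
  have p2 : 0 < a - q * D - (q * C - E) := by nlinarith
  have n1 : (∃ t > 0, Qt q a C D E 1 t) → 0 < E + q * C := by
    rintro ⟨t, ht, h, -⟩
    nlinarith [mul_pos ht p2]
  have n2 : (∃ t > 0, Qt q a C D E (-1) t) → E + q * C < 0 := by
    rintro ⟨t, ht, h, -⟩
    nlinarith [mul_pos ht p1]
  have n0 : Qc q a C D E → E + q * C = 0 := fun h => h.1
  rcases lt_trichotomy (E + q * C) 0 with h | h | h
  · refine Or.inr (Or.inr ⟨fun h' => by linarith [n0 h'], fun h' => by linarith [n1 h'], ?_⟩)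
    obtain ⟨τ, hτ⟩ : ∃ τ, τ = -(E + q * C) / (a - q * D + (q * C - E)) := ⟨_, rfl⟩
    have hτ0 : 0 < τ := by rw [hτ]; exact div_pos (by linarith) p1
    have hτe : τ * (a - q * D + (q * C - E)) = -(E + q * C) := by rw [hτ]; field_simp
    refine ⟨τ, hτ0, aux_Q hq0 hq1 (by linear_combination hdet) ?_ ?_ ?_ ?_ (Or.inr ⟨?_, ?_⟩) ?_⟩ <;>
      nlinarith [mul_pos hτ0 hu, mul_pos hτ0 ht]
  · exact Or.inl ⟨aux_Q hq0 hq1 hdet hs ht hu hw (Or.inl ⟨hs1, hw1⟩) h,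
      fun h' => by linarith [n1 h'], fun h' => by linarith [n2 h']⟩
  · refine Or.inr (Or.inl ⟨fun h' => by linarith [n0 h'], ?_, fun h' => by linarith [n2 h']⟩)
    obtain ⟨τ, hτ⟩ : ∃ τ, τ = (E + q * C) / (a - q * D - (q * C - E)) := ⟨_, rfl⟩
    have hτ0 : 0 < τ := by rw [hτ]; exact div_pos (by linarith) p2
    have hτe : τ * (a - q * D - (q * C - E)) = (E + q * C) := by rw [hτ]; field_simp
    refine ⟨τ, hτ0, aux_Q hq0 hq1 (by linear_combination hdet) ?_ ?_ ?_ ?_ (Or.inl ⟨?_, ?_⟩) ?_⟩ <;>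
      nlinarith [mul_pos hτ0 hs, mul_pos hτ0 hw]

lemma mk_eq_cases {A A' : SL2} (h : (QuotientGroup.mk A : PSL2) = QuotientGroup.mk A') :
    A' = A ∨ A' = -A := by
  rw [QuotientGroup.eq, Matrix.SpecialLinearGroup.mem_center_iff] at h
  obtain ⟨r, hr, hs⟩ := h
  have hA : A' = A * (A⁻¹ * A') := by group
  have : r = 1 ∨ r = -1 := by
    simpa using hr
  rcases this with rfl | rfl
  · left
    rw [hA]
    have : A⁻¹ * A' = 1 := by
      ext i j; rw [← hs]; simp
    rw [this, mul_one]
  · right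
    rw [hA]
    have : A⁻¹ * A' = -1 := by
      ext i j; rw [← hs]; fin_cases i <;> fin_cases j <;> simp
    rw [this]; simp

lemma mk_neg_eq (A : SL2) : (QuotientGroup.mk (-A) : PSL2) = QuotientGroup.mk A := by
  rw [QuotientGroup.eq, Matrix.SpecialLinearGroup.mem_center_iff]
  refine ⟨-1, by simp, ?_⟩
  have : (-A)⁻¹ * A = -1 := by
    rw [inv_mul_eq_iff_eq_mul]; simp
  rw [this]
  ext i j; fin_cases i <;> fin_cases j <;> simp

lemma pslSMul_mk (A : SL2) (z : ℍ) : pslSMul (QuotientGroup.mk A) z = A • z := by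
  unfold pslSMul
  have h : (QuotientGroup.mk (Quotient.out (QuotientGroup.mk A : PSL2)) : PSL2) = QuotientGroup.mk A :=
    Quotient.out_eq _
  generalize (Quotient.out (QuotientGroup.mk A : PSL2) : SL2) = B at h ⊢
  rcases mk_eq_cases h with rfl | rfl
  · rfl
  · apply UpperHalfPlane.ext
    rw [UpperHalfPlane.coe_specialLinearGroup_apply, UpperHalfPlane.coe_specialLinearGroup_apply,
      Matrix.SpecialLinearGroup.coe_neg, ← neg_div_neg_eq]
    simp only [Matrix.neg_apply, map_neg, Complex.ofReal_neg]
    congr 1 <;> ring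

lemma SQell_mk (R : ℝ) (hR : 1 < R) (A : SL2) : (QuotientGroup.mk A : PSL2) ∈ SQell R ↔
    Qc (1 / R ^ 2) (A 0 0) (A 1 0 / R) (A 1 1 / R ^ 2) (A 0 1 / R) := by
  have hR0 : 0 < R := by linarith
  have hq : (0 : ℝ) < 1 / R ^ 2 := by positivity
  have key : ∀ a b c d v : ℝ, b = -v / R → c = v * R →
      ((|a| < |d| ∧ 2 * |v| < |a - d|) ↔ Qc (1 / R ^ 2) a (c / R) (d / R ^ 2) (b / R)) := by
    rintro a b c d v rfl rfl
    unfold Qc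
    have e1 : |d / R ^ 2| = 1 / R ^ 2 * |d| := by
      rw [div_eq_inv_mul, abs_mul, ← one_div, abs_of_pos hq]
    have e2 : |1 / R ^ 2 * a - d / R ^ 2| = 1 / R ^ 2 * |a - d| := by
      rw [← abs_of_pos hq, ← abs_mul, abs_of_pos hq]; congr 1; ring
    have e3 : v * R / R = v := by field_simp
    rw [e1, e2, e3, mul_comm 2 (1 / R ^ 2), mul_assoc, mul_lt_mul_iff_right₀ hq,
      mul_lt_mul_iff_right₀ hq]
    constructor
    · intro h; exact ⟨by field_simp; ring, h.1, h.2⟩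
    · intro h; exact ⟨h.2.1, h.2.2⟩
  constructor
  · rintro ⟨B, α, β, v, hB, hm, h1, h2⟩
    have := (key α (-v / R) (v * R) β v rfl rfl).1 ⟨h1, h2⟩
    have b00 : B 0 0 = α := by rw [hm]; simp
    have b01 : B 0 1 = -v / R := by rw [hm]; simp
    have b10 : B 1 0 = v * R := by rw [hm]; simp
    have b11 : B 1 1 = β := by rw [hm]; simp
    rcases mk_eq_cases hB with rfl | rfl
    · rwa [b00, b01, b10, b11]
    · simp only [Matrix.SpecialLinearGroup.coe_neg, Matrix.neg_apply, b00, b01, b10, b11]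
      have := (key (-α) (-(-v / R)) (-(v * R)) (-β) (-v) (by ring) (by ring)).1
        ⟨by simpa using h1, by rw [abs_neg, show -α - -β = -(α - β) by ring, abs_neg]; exact h2⟩
      exact this
  · intro h
    have h0 := h.1
    have hc : A 0 1 = -(A 1 0 / R) / R := by
      field_simp at h0 ⊢; linarith
    have := (key (A 0 0) (A 0 1) (A 1 0) (A 1 1) (A 1 0 / R) hc (by field_simp)).2 h
    refine ⟨A, A 0 0, A 1 1, A 1 0 / R, rfl, ?_, this.1, this.2⟩
    ext i j; fin_cases i <;> fin_cases j <;> simp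
    · exact hc
    · field_simp

/-- the anti-involution `[[a,b],[c,d]] ↦ [[a,-c],[-b,d]]`. -/
def fl (A : SL2) : SL2 := ⟨!![A 0 0, -A 1 0; -A 0 1, A 1 1], by
  have := A.2; rw [Matrix.det_fin_two] at this; rw [Matrix.det_fin_two]; simp; linarith⟩

lemma SQinv_mk (R : ℝ) (hR : 1 < R) (A : SL2) : (QuotientGroup.mk A : PSL2) ∈ SQell'inv R ↔
    Qc (1 / R ^ 2) (A 0 0) (-(A 0 1 / R)) (A 1 1 / R ^ 2) (-(A 1 0 / R)) := by
  have hR0 : 0 < R := by linarith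
  have h1 : Qc (1 / R ^ 2) (A 0 0) (-(A 0 1 / R)) (A 1 1 / R ^ 2) (-(A 1 0 / R)) ↔
      (QuotientGroup.mk (fl A) : PSL2) ∈ SQell R := by
    rw [SQell_mk R hR]; simp [fl, neg_div]
  rw [h1]
  have flneg : ∀ B, fl (-B) = - fl B := by
    intro B; ext i j; rw [Matrix.SpecialLinearGroup.coe_neg]
    fin_cases i <;> fin_cases j <;> simp [fl]
  have flfl : ∀ B, fl (fl B) = B := by
    intro B; ext i j; fin_cases i <;> fin_cases j <;> simp [fl]
  have flmk : ∀ B B' : SL2, (QuotientGroup.mk B : PSL2) = QuotientGroup.mk B' →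
      (QuotientGroup.mk (fl B) : PSL2) = QuotientGroup.mk (fl B') := by
    intro B B' h
    rcases mk_eq_cases h with rfl | rfl
    · rfl
    · rw [flneg, mk_neg_eq]
  constructor
  · rintro ⟨B, α, β, v, hB, hm, h1, h2⟩
    refine ⟨fl B, α, β, -v, flmk _ _ hB, ?_, h1, by simpa using h2⟩
    ext i j; fin_cases i <;> fin_cases j <;> simp [fl, hm] <;> ring
  · rintro ⟨B, α, β, v, hB, hm, h1, h2⟩
    refine ⟨fl B, α, β, -v, by rw [flmk _ _ hB, flfl], ?_, h1, by simpa using h2⟩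
    ext i j; fin_cases i <;> fin_cases j <;> simp [fl, hm] <;> ring

lemma lim_le {F G : ℝ → ℝ} (hF : Continuous F) (hG : Continuous G)
    (h : ∀ θ, 0 < θ → θ < 1 → F θ ≤ G θ) : F 0 ≤ G 0 := by
  have h1 : Tendsto F (𝓝[>] 0) (𝓝 (F 0)) := hF.continuousAt.tendsto.mono_left nhdsWithin_le_nhds
  have h2 : Tendsto G (𝓝[>] 0) (𝓝 (G 0)) := hG.continuousAt.tendsto.mono_left nhdsWithin_le_nhds
  refine le_of_tendsto_of_tendsto h1 h2 ?_
  filter_upwards [Ioo_mem_nhdsGT (show (0 : ℝ) < 1 by norm_num)] with θ hθ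
  exact h θ hθ.1 hθ.2

def pt (r σ θ : ℝ) : ℍ :=
  if h : 0 < r * Real.sin θ then ⟨⟨r * σ * Real.cos θ, r * Real.sin θ⟩, h⟩ else UpperHalfPlane.I

lemma sin_pos01 {θ : ℝ} (h0 : 0 < θ) (h1 : θ < 1) : 0 < Real.sin θ :=
  Real.sin_pos_of_pos_of_lt_pi h0 (by linarith [Real.pi_gt_three])

lemma pt_coe {r σ θ : ℝ} (hr : 0 < r) (h0 : 0 < θ) (h1 : θ < 1) :
    (pt r σ θ : ℂ) = ⟨r * σ * Real.cos θ, r * Real.sin θ⟩ := by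
  have := mul_pos hr (sin_pos01 h0 h1)
  simp [pt, this]

lemma pt_re {r σ θ : ℝ} (hr : 0 < r) (h0 : 0 < θ) (h1 : θ < 1) :
    (pt r σ θ).re = r * σ * Real.cos θ := by
  have := congrArg Complex.re (pt_coe (σ := σ) hr h0 h1); simpa using this

lemma pt_im {r σ θ : ℝ} (hr : 0 < r) (h0 : 0 < θ) (h1 : θ < 1) :
    (pt r σ θ).im = r * Real.sin θ := by
  have := congrArg Complex.im (pt_coe (σ := σ) hr h0 h1); simpa using this

lemma norm_sq_H (z : ℍ) : ‖(z : ℂ)‖ ^ 2 = z.re ^ 2 + z.im ^ 2 := by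
  rw [Complex.sq_norm, Complex.normSq_apply]; simp; ring

lemma pt_mem {r σ θ : ℝ} (hr : 0 < r) (hσ : σ ^ 2 = 1) (h0 : 0 < θ) (h1 : θ < 1) :
    pt r σ θ ∈ circ r := by
  have := norm_sq_H (pt r σ θ)
  rw [pt_re hr h0 h1, pt_im hr h0 h1] at this
  have e : ‖(pt r σ θ : ℂ)‖ ^ 2 = r ^ 2 := by
    rw [this, mul_pow, mul_pow, hσ, mul_pow]
    linear_combination r ^ 2 * Real.sin_sq_add_cos_sq θ
  exact (sq_eq_sq₀ (norm_nonneg _) hr.le).1 e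

lemma smul_coe (A : SL2) (z : ℍ) :
    ((A • z : ℍ) : ℂ) = ((A 0 0 : ℂ) * z + A 0 1) / ((A 1 0 : ℂ) * z + A 1 1) := by
  rw [UpperHalfPlane.coe_specialLinearGroup_apply]; simp

lemma den_pos (A : SL2) (z : ℍ) :
    0 < (A 1 0 * z.re + A 1 1) ^ 2 + (A 1 0 * z.im) ^ 2 := by
  have hd := A.2
  rw [Matrix.det_fin_two] at hd
  by_contra hc
  have h1 : (A 1 0 * z.im) = 0 := by nlinarith [sq_nonneg (A 1 0 * z.re + A 1 1), sq_nonneg (A 1 0 * z.im)]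
  have h2 : A 1 0 = 0 := by simpa [z.im_ne_zero] using h1
  rw [h2] at hc hd
  have h3 : A 1 1 = 0 := by nlinarith [sq_nonneg (A 1 1)]
  rw [h3] at hd; simp at hd

lemma smul_norm (A : SL2) (z : ℍ) :
    ‖((A • z : ℍ) : ℂ)‖ ^ 2 * ((A 1 0 * z.re + A 1 1) ^ 2 + (A 1 0 * z.im) ^ 2) =
      (A 0 0 * z.re + A 0 1) ^ 2 + (A 0 0 * z.im) ^ 2 := by
  have hp := den_pos A z
  have e1 : Complex.normSq ((A 0 0 : ℂ) * z + A 0 1) =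
      (A 0 0 * z.re + A 0 1) ^ 2 + (A 0 0 * z.im) ^ 2 := by
    rw [Complex.normSq_apply]; simp; ring
  have e2 : Complex.normSq ((A 1 0 : ℂ) * z + A 1 1) =
      (A 1 0 * z.re + A 1 1) ^ 2 + (A 1 0 * z.im) ^ 2 := by
    rw [Complex.normSq_apply]; simp; ring
  rw [smul_coe, Complex.sq_norm, Complex.normSq_div, e1, e2, div_mul_cancel₀ _ hp.ne']

lemma cosh_smul (A : SL2) (z w : ℍ) :
    Real.cosh (dist z (A • w)) * (2 * z.im * w.im) =
      (z.re ^ 2 + z.im ^ 2) * ((A 1 0 * w.re + A 1 1) ^ 2 + (A 1 0 * w.im) ^ 2) +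
      ((A 0 0 * w.re + A 0 1) ^ 2 + (A 0 0 * w.im) ^ 2) -
      2 * z.re * ((A 0 0 * w.re + A 0 1) * (A 1 0 * w.re + A 1 1) + A 0 0 * A 1 0 * w.im ^ 2) := by
  have hp := den_pos A w
  have hd := A.2
  rw [Matrix.det_fin_two] at hd
  have hz := z.im_pos
  have hw := w.im_pos
  have e2 : Complex.normSq ((A 1 0 : ℂ) * w + A 1 1) =
      (A 1 0 * w.re + A 1 1) ^ 2 + (A 1 0 * w.im) ^ 2 := by
    rw [Complex.normSq_apply]; simp; ring
  have hn := smul_norm A w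
  rw [norm_sq_H] at hn
  have hre : (A • w).re * ((A 1 0 * w.re + A 1 1) ^ 2 + (A 1 0 * w.im) ^ 2) =
      (A 0 0 * w.re + A 0 1) * (A 1 0 * w.re + A 1 1) + A 0 0 * A 1 0 * w.im ^ 2 := by
    rw [← UpperHalfPlane.coe_re, smul_coe, Complex.div_re, e2, ← add_div, div_mul_cancel₀ _ hp.ne']
    simp; ring
  have him : (A • w).im * ((A 1 0 * w.re + A 1 1) ^ 2 + (A 1 0 * w.im) ^ 2) = w.im := by
    rw [← UpperHalfPlane.coe_im, smul_coe, Complex.div_im, e2, ← sub_div, div_mul_cancel₀ _ hp.ne']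
    simp; linear_combination w.im * hd
  have hi := (A • w).im_pos
  rw [UpperHalfPlane.cosh_dist']
  generalize (A 1 0 * w.re + A 1 1) ^ 2 + (A 1 0 * w.im) ^ 2 = N at *
  rw [← hn, ← hre, ← him]
  field_simp
  ring

lemma cosh_bound {x y c : ℝ} (hx : 0 ≤ x) (hy : 0 ≤ y) (h : x - y ≤ c) (hc : c < 0) :
    Real.cosh x ≤ Real.exp c * Real.cosh y + (Real.exp (-c) - Real.exp c) / 2 := by
  have h1 : Real.cosh x ≤ Real.cosh (y + c) := by
    rw [Real.cosh_le_cosh, abs_of_nonneg hx, abs_of_nonneg (by linarith)]; linarith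
  have h2 : Real.cosh (y + c) = Real.exp c * Real.cosh y +
      Real.exp (-y) * ((Real.exp (-c) - Real.exp c) / 2) := by
    rw [Real.cosh_eq, Real.cosh_eq, neg_add, Real.exp_add, Real.exp_add]; ring
  have h3 : Real.exp (-y) ≤ 1 := by rw [Real.exp_le_one_iff]; linarith
  have h4 : Real.exp c ≤ Real.exp (-c) := Real.exp_le_exp.2 (by linarith)
  nlinarith

lemma corner (R : ℝ) (hR : 1 < R) (A : SL2)
    (hsup : ∃ c < 0, ∀ x ∈ circ (1 / R), ∀ x' ∈ circ R,
      dist x (A • x') - dist x x' ≤ c) {σ τ : ℝ} (hσ : σ ^ 2 = 1) (hτ : τ ^ 2 = 1) :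
    (σ / R * (A 1 0 * (R * τ) + A 1 1) - (A 0 0 * (R * τ) + A 0 1)) ^ 2 < (σ / R - R * τ) ^ 2 := by
  obtain ⟨c, hc, hs⟩ := hsup
  have hR0 : 0 < R := by linarith
  have hR1 : 0 < 1 / R := by positivity
  set K := (Real.exp (-c) - Real.exp c) / 2 with hK
  let re (θ : ℝ) := 1 / R * σ * Real.cos θ
  let im (θ : ℝ) := 1 / R * Real.sin θ
  let re' (θ : ℝ) := R * τ * Real.cos θ
  let im' (θ : ℝ) := R * Real.sin θ
  have main := @lim_le
    (fun θ => (re θ ^ 2 + im θ ^ 2) * ((A 1 0 * re' θ + A 1 1) ^ 2 + (A 1 0 * im' θ) ^ 2) +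
      ((A 0 0 * re' θ + A 0 1) ^ 2 + (A 0 0 * im' θ) ^ 2) -
      2 * re θ * ((A 0 0 * re' θ + A 0 1) * (A 1 0 * re' θ + A 1 1) + A 0 0 * A 1 0 * im' θ ^ 2))
    (fun θ => Real.exp c * ((re θ - re' θ) ^ 2 + im θ ^ 2 + im' θ ^ 2) + K * (2 * im θ * im' θ))
    (by fun_prop) (by fun_prop) (by
      intro θ h0 h1
      have hb := cosh_bound dist_nonneg dist_nonneg
        (hs _ (pt_mem hR1 hσ h0 h1) _ (pt_mem hR0 hτ h0 h1)) hc
      have e := cosh_smul A (pt (1 / R) σ θ) (pt R τ θ)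
      have e' := UpperHalfPlane.cosh_dist' (pt (1 / R) σ θ) (pt R τ θ)
      have p1 := (pt (1 / R) σ θ).im_pos
      have p2 := (pt R τ θ).im_pos
      rw [eq_div_iff (by positivity)] at e'
      have hb2 := mul_le_mul_of_nonneg_right hb (by positivity :
        0 ≤ 2 * (pt (1 / R) σ θ).im * (pt R τ θ).im)
      rw [e, add_mul (Real.exp c * _), mul_assoc (Real.exp c), e'] at hb2
      rw [pt_re hR1 h0 h1, pt_re hR0 h0 h1, pt_im hR1 h0 h1, pt_im hR0 h0 h1] at hb2
      exact hb2)
  simp only [re, im, re', im', Real.cos_zero, Real.sin_zero] at main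
  have hexp : Real.exp c < 1 := by rwa [Real.exp_lt_one_iff]
  have hpos : 0 < (σ / R - R * τ) ^ 2 := by
    have h1 : (σ / R) ^ 2 < 1 := by
      rw [div_pow, hσ, div_lt_one (by positivity)]; nlinarith
    have h2 : 1 < (R * τ) ^ 2 := by rw [mul_pow, hτ]; nlinarith
    refine (sq_nonneg _).lt_of_ne fun h => ?_
    have : σ / R = R * τ := by
      have := pow_eq_zero_iff (two_ne_zero) |>.1 h.symm
      linarith
    rw [this] at h1; linarith
  have : Real.exp c * (σ / R - R * τ) ^ 2 < (σ / R - R * τ) ^ 2 := by nlinarith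
  refine lt_of_le_of_lt ?_ this
  calc _ = _ := ?_
    _ ≤ _ := main
    _ = _ := ?_
  · ring
  · ring

lemma tendsto_pt {r σ : ℝ} (hr : 0 < r) :
    Tendsto (fun θ => (pt r σ θ : ℂ)) (𝓝[>] 0) (𝓝 ((r * σ : ℝ) : ℂ)) := by
  have h : Continuous (fun θ : ℝ => ((r * σ * Real.cos θ : ℝ) : ℂ) + ((r * Real.sin θ : ℝ) : ℂ) * Complex.I) := by
    fun_prop
  have h1 := (h.tendsto 0).mono_left (nhdsWithin_le_nhds (s := Set.Ioi 0))
  have h2 : Tendsto (fun θ : ℝ => ((r * σ * Real.cos θ : ℝ) : ℂ) + ((r * Real.sin θ : ℝ) : ℂ) * Complex.I)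
      (𝓝[>] 0) (𝓝 ((r * σ : ℝ) : ℂ)) := by
    convert h1 using 2; simp
  refine h2.congr' ?_
  filter_upwards [Ioo_mem_nhdsGT (show (0 : ℝ) < 1 by norm_num)] with θ hθ
  rw [pt_coe hr hθ.1 hθ.2]
  apply Complex.ext <;> simp [-Complex.ofReal_mul, -Complex.ofReal_cos, -Complex.ofReal_sin]

lemma side1 (R : ℝ) (hR : 1 < R) (A : SL2)
    (hcl : Disjoint (closure (embH '' circ (1 / R)))
      (closure (embH '' ((fun z => A • z) '' (circ R)))))
    (h1 : ∀ z ∈ circ R, 1 / R < ‖((A • z : ℍ) : ℂ)‖) {τ : ℝ} (hτ : τ ^ 2 = 1) :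
    (1 / R) ^ 2 * (A 1 0 * (R * τ) + A 1 1) ^ 2 < (A 0 0 * (R * τ) + A 0 1) ^ 2 := by
  have hR0 : 0 < R := by linarith
  have hR1 : 0 < 1 / R := by positivity
  have hd := A.2
  rw [Matrix.det_fin_two] at hd
  have hle := @lim_le
    (fun θ => (1 / R) ^ 2 * ((A 1 0 * (R * τ * Real.cos θ) + A 1 1) ^ 2 + (A 1 0 * (R * Real.sin θ)) ^ 2))
    (fun θ => (A 0 0 * (R * τ * Real.cos θ) + A 0 1) ^ 2 + (A 0 0 * (R * Real.sin θ)) ^ 2)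
    (by fun_prop) (by fun_prop) (by
      intro θ t0 t1
      have e := smul_norm A (pt R τ θ)
      have hp := den_pos A (pt R τ θ)
      have hn := h1 _ (pt_mem hR0 hτ t0 t1)
      have hn2 : (1 / R) ^ 2 ≤ ‖((A • pt R τ θ : ℍ) : ℂ)‖ ^ 2 := by gcongr
      have := mul_le_mul_of_nonneg_right hn2 hp.le
      rw [e, pt_re hR0 t0 t1, pt_im hR0 t0 t1] at this
      exact this)
  simp only [Real.cos_zero, Real.sin_zero, mul_one, mul_zero] at hle
  refine lt_of_le_of_ne (by simpa using hle) fun heq => ?_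
  set N := A 1 0 * (R * τ) + A 1 1 with hN
  set M := A 0 0 * (R * τ) + A 0 1 with hM
  have hN0 : N ≠ 0 := by
    intro h0
    have hM0 : M = 0 := by
      rw [h0] at heq; simpa using heq.symm
    have : A 0 0 * N - A 1 0 * M = 1 := by rw [hN, hM]; linear_combination hd
    rw [h0, hM0] at this; simp at this
  have hσ : (R * M / N) ^ 2 = 1 := by
    rw [div_pow, mul_pow, ← heq]; field_simp
  have hdis := Set.disjoint_left.1 hcl
  refine @hdis (((1 / R * (R * M / N) : ℝ) : ℂ) : OnePoint ℂ) ?_ ?_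
  · refine mem_closure_of_tendsto
      ((OnePoint.continuous_coe.tendsto _).comp (tendsto_pt (σ := R * M / N) hR1)) ?_
    filter_upwards [Ioo_mem_nhdsGT (show (0 : ℝ) < 1 by norm_num)] with θ hθ
    exact ⟨_, pt_mem hR1 hσ hθ.1 hθ.2, rfl⟩
  · have ht := tendsto_pt (σ := τ) hR0
    have hden : (A 1 0 : ℂ) * ((R * τ : ℝ) : ℂ) + A 1 1 = (N : ℂ) := by rw [hN]; push_cast; ring
    have hnum : (A 0 0 : ℂ) * ((R * τ : ℝ) : ℂ) + A 0 1 = (M : ℂ) := by rw [hM]; push_cast; ring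
    have ht2 := ((ht.const_mul (A 0 0 : ℂ)).add_const (A 0 1 : ℂ)).div
      ((ht.const_mul (A 1 0 : ℂ)).add_const (A 1 1 : ℂ)) (by rw [hden]; exact_mod_cast hN0)
    rw [hnum, hden] at ht2
    have hval : (M : ℂ) / N = ((1 / R * (R * M / N) : ℝ) : ℂ) := by
      rw [← Complex.ofReal_div]; congr 1; field_simp
    rw [hval] at ht2
    refine mem_closure_of_tendsto ((OnePoint.continuous_coe.tendsto _).comp ht2) ?_
    filter_upwards [Ioo_mem_nhdsGT (show (0 : ℝ) < 1 by norm_num)] with θ hθ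
    refine ⟨A • pt R τ θ, ⟨_, pt_mem hR0 hτ hθ.1 hθ.2, rfl⟩, ?_⟩
    simp only [embH, smul_coe, Function.comp]
    rfl

lemma side2 (R : ℝ) (hR : 1 < R) (B : SL2)
    (h2 : ∀ z ∈ circ (1 / R), ‖((B • z : ℍ) : ℂ)‖ < R) :
    (B 0 0 * (1 / R) + B 0 1) ^ 2 ≤ R ^ 2 * (B 1 0 * (1 / R) + B 1 1) ^ 2 := by
  have hR0 : 0 < R := by linarith
  have hR1 : 0 < 1 / R := by positivity
  have hle := @lim_le
    (fun θ => (B 0 0 * (1 / R * 1 * Real.cos θ) + B 0 1) ^ 2 + (B 0 0 * (1 / R * Real.sin θ)) ^ 2)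
    (fun θ => R ^ 2 * ((B 1 0 * (1 / R * 1 * Real.cos θ) + B 1 1) ^ 2 + (B 1 0 * (1 / R * Real.sin θ)) ^ 2))
    (by fun_prop) (by fun_prop) (by
      intro θ t0 t1
      have e := smul_norm B (pt (1 / R) 1 θ)
      have hp := den_pos B (pt (1 / R) 1 θ)
      have hn := h2 _ (pt_mem (σ := 1) hR1 (by norm_num) t0 t1)
      have hn2 : ‖((B • pt (1 / R) 1 θ : ℍ) : ℂ)‖ ^ 2 ≤ R ^ 2 := by gcongr
      have := mul_le_mul_of_nonneg_right hn2 hp.le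
      rw [e, pt_re hR1 t0 t1, pt_im hR1 t0 t1] at this
      exact this)
  simpa using hle

/-- all the inequalities in normalized coordinates, up to sign. -/
lemma real_facts {R q a b c d : ℝ} (hR : 1 < R) (hq : q = 1 / R ^ 2)
    (k : ∀ σ τ : ℝ, σ ^ 2 = 1 → τ ^ 2 = 1 →
      (σ / R * (c * (R * τ) + d) - (a * (R * τ) + b)) ^ 2 < (σ / R - R * τ) ^ 2)
    (s1 : ∀ τ : ℝ, τ ^ 2 = 1 →
      (1 / R) ^ 2 * (c * (R * τ) + d) ^ 2 < (a * (R * τ) + b) ^ 2)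
    (s2 : (d * (1 / R) - b) ^ 2 ≤ R ^ 2 * (-c * (1 / R) + a) ^ 2) :
    ∃ e : ℝ, (e = 1 ∨ e = -1) ∧ ∀ A C D E : ℝ, A = e * a → C = e * (c / R) →
      D = e * (d / R ^ 2) → E = e * (b / R) →
      (0 < A + E - C - D ∧ 0 < A + C - D - E ∧ 0 < A + D - C - E ∧ 0 < A + C + D + E ∧
       A + E - C - D < 1 - q ∧ A + C + D + E < 1 + q ∧
       A + C - D - E < 1 - q ∧ A + D - C - E < 1 + q) := by
  have hR0 : 0 < R := by linarith
  have hq0 : 0 < q := by rw [hq]; positivity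
  have hq1 : q < 1 := by rw [hq, div_lt_one (by positivity)]; nlinarith
  obtain ⟨C, hC⟩ : ∃ C, C = c / R := ⟨_, rfl⟩
  obtain ⟨D, hD⟩ : ∃ D, D = d / R ^ 2 := ⟨_, rfl⟩
  obtain ⟨E, hE⟩ : ∃ E, E = b / R := ⟨_, rfl⟩
  have hc : c = C * R := by rw [hC]; field_simp
  have hdd : d = D * R ^ 2 := by rw [hD]; field_simp
  have hb : b = E * R := by rw [hE]; field_simp
  rw [← hC, ← hD, ← hE]
  have hRR : 0 < R ^ 2 := by positivity
  have kk : ∀ σ τ : ℝ, σ ^ 2 = 1 → τ ^ 2 = 1 →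
      (σ * τ * C + σ * D - τ * a - E) ^ 2 < (σ * q - τ) ^ 2 := by
    intro σ τ h1 h2
    have := k σ τ h1 h2
    have e1 : σ / R * (c * (R * τ) + d) - (a * (R * τ) + b) = R * (σ * τ * C + σ * D - τ * a - E) := by
      rw [hc, hdd, hb]; field_simp; ring
    have e2 : σ / R - R * τ = R * (σ * q - τ) := by rw [hq]; field_simp
    rw [e1, e2, mul_pow, mul_pow] at this
    exact lt_of_mul_lt_mul_left this hRR.le
  have ss : ∀ τ : ℝ, τ ^ 2 = 1 → (C * τ + D) ^ 2 < (a * τ + E) ^ 2 := by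
    intro τ h2
    have := s1 τ h2
    have e1 : (1 / R) ^ 2 * (c * (R * τ) + d) ^ 2 = R ^ 2 * (C * τ + D) ^ 2 := by
      rw [hc, hdd]; field_simp
    have e2 : (a * (R * τ) + b) ^ 2 = R ^ 2 * (a * τ + E) ^ 2 := by rw [hb]; ring
    rw [e1, e2] at this
    exact lt_of_mul_lt_mul_left this hRR.le
  have s3 : (D - E) ^ 2 ≤ (a - C) ^ 2 := by
    have e1 : (d * (1 / R) - b) ^ 2 = R ^ 2 * (D - E) ^ 2 := by
      rw [hdd, hb]; field_simp
    have e2 : R ^ 2 * (-c * (1 / R) + a) ^ 2 = R ^ 2 * (a - C) ^ 2 := by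
      rw [hc]; field_simp; ring
    rw [e1, e2] at s2
    exact le_of_mul_le_mul_left s2 hRR
  have kpp := kk 1 1 (by norm_num) (by norm_num)
  have kpm := kk 1 (-1) (by norm_num) (by norm_num)
  have kmp := kk (-1) 1 (by norm_num) (by norm_num)
  have kmm := kk (-1) (-1) (by norm_num) (by norm_num)
  have sp := ss 1 (by norm_num)
  have sm := ss (-1) (by norm_num)
  have bpp : |a + E - C - D| < 1 - q := by
    rw [← abs_of_pos (show 0 < 1 - q by linarith), ← sq_lt_sq]; linarith
  have bmm : |a + C - D - E| < 1 - q := by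
    rw [← abs_of_pos (show 0 < 1 - q by linarith), ← sq_lt_sq]; linarith
  have bpm : |a + D - C - E| < 1 + q := by
    rw [← abs_of_pos (show 0 < 1 + q by linarith), ← sq_lt_sq]; linarith
  have bmp : |a + C + D + E| < 1 + q := by
    rw [← abs_of_pos (show 0 < 1 + q by linarith), ← sq_lt_sq]; linarith
  rw [abs_lt] at bpp bmm bpm bmp
  have g1 : 0 < (a + E - C - D) * (a + C + D + E) := by linarith
  have g2 : 0 < (a + D - C - E) * (a + C - D - E) := by linarith
  have g3 : 0 ≤ (a + D - C - E) * (a + E - C - D) := by linarith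
  rcases pos_and_pos_or_neg_and_neg_of_mul_pos g1 with ⟨p1, p2⟩ | ⟨p1, p2⟩
  · have p3 : 0 ≤ a + D - C - E := nonneg_of_mul_nonneg_left g3 p1
    have p4 : 0 < a + D - C - E := p3.lt_of_ne (by rintro h; rw [← h] at g2; simp at g2)
    have p5 : 0 < a + C - D - E := pos_of_mul_pos_right g2 p4.le
    refine ⟨1, Or.inl rfl, ?_⟩
    rintro _ _ _ _ rfl rfl rfl rfl
    refine ⟨?_, ?_, ?_, ?_, ?_, ?_, ?_, ?_⟩ <;> linarith
  · have p4 : a + D - C - E < 0 := by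
      by_contra hh
      push Not at hh
      rcases hh.eq_or_lt with hh | hh
      · rw [← hh] at g2; simp at g2
      · exact absurd (mul_neg_of_pos_of_neg hh p1) (not_lt.2 g3)
    have p5 : a + C - D - E < 0 := by
      by_contra hh
      push Not at hh
      exact absurd (mul_nonpos_of_nonpos_of_nonneg p4.le hh) (not_le.2 g2)
    refine ⟨-1, Or.inr rfl, ?_⟩
    rintro _ _ _ _ rfl rfl rfl rfl
    refine ⟨?_, ?_, ?_, ?_, ?_, ?_, ?_, ?_⟩ <;> linarith

theorem stmt18 (R : ℝ) (hR : 1 < R)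
    (P P' : ℝ → ℝ → PSL2)
    (hP : ∀ ε : ℝ, (ε = 1 ∨ ε = -1) → ∀ t : ℝ,
      ∃ A : SL2, (QuotientGroup.mk A : PSL2) = P ε t ∧
        (A : Matrix (Fin 2) (Fin 2) ℝ) = !![1 - t, -ε * t / R; ε * R * t, 1 + t])
    (hP' : ∀ ε : ℝ, (ε = 1 ∨ ε = -1) → ∀ t : ℝ,
      ∃ A : SL2, (QuotientGroup.mk A : PSL2) = P' ε t ∧
        (A : Matrix (Fin 2) (Fin 2) ℝ) = !![1 + t, -ε * R * t; ε * t / R, 1 - t])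
    (h : PSL2)
    (hsup : ∃ c < 0, ∀ x ∈ circ (1 / R), ∀ x' ∈ circ R,
      dist x (pslSMul h x') - dist x x' ≤ c)
    (hcl : Disjoint (closure (embH '' circ (1 / R)))
      (closure (embH '' pslImg h (circ R))))
    (h1 : pslImg h (circ R) ⊆ {z : ℍ | 1 / R < ‖(z : ℂ)‖})
    (h2 : pslImg h⁻¹ (circ (1 / R)) ⊆ {z : ℍ | ‖(z : ℂ)‖ < R}) :
    (((h ∈ SQell R) ∧ ¬(∃ t > 0, h * P' 1 t ∈ SQell R) ∧
        ¬(∃ t > 0, h * P' (-1) t ∈ SQell R)) ∨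
      (¬(h ∈ SQell R) ∧ (∃ t > 0, h * P' 1 t ∈ SQell R) ∧
        ¬(∃ t > 0, h * P' (-1) t ∈ SQell R)) ∨
      (¬(h ∈ SQell R) ∧ ¬(∃ t > 0, h * P' 1 t ∈ SQell R) ∧
        (∃ t > 0, h * P' (-1) t ∈ SQell R))) ∧
    (((h ∈ SQell'inv R) ∧ ¬(∃ t > 0, (P 1 t)⁻¹ * h ∈ SQell'inv R) ∧
        ¬(∃ t > 0, (P (-1) t)⁻¹ * h ∈ SQell'inv R)) ∨
      (¬(h ∈ SQell'inv R) ∧ (∃ t > 0, (P 1 t)⁻¹ * h ∈ SQell'inv R) ∧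
        ¬(∃ t > 0, (P (-1) t)⁻¹ * h ∈ SQell'inv R)) ∨
      (¬(h ∈ SQell'inv R) ∧ ¬(∃ t > 0, (P 1 t)⁻¹ * h ∈ SQell'inv R) ∧
        (∃ t > 0, (P (-1) t)⁻¹ * h ∈ SQell'inv R))) := by
  obtain ⟨A, rfl⟩ := QuotientGroup.mk_surjective h
  have hR0 : 0 < R := by linarith
  have hd := A.2
  rw [Matrix.det_fin_two] at hd
  have hact : pslSMul (QuotientGroup.mk A : PSL2) = fun z => A • z := funext (pslSMul_mk A)
  have hact' : pslSMul (QuotientGroup.mk A : PSL2)⁻¹ = fun z => A⁻¹ • z := funext (pslSMul_mk A⁻¹)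
  simp only [pslImg, hact, hact'] at hsup hcl h1 h2
  have h1' : ∀ z ∈ circ R, 1 / R < ‖((A • z : ℍ) : ℂ)‖ := fun z hz => h1 ⟨z, hz, rfl⟩
  have h2' : ∀ z ∈ circ (1 / R), ‖((A⁻¹ • z : ℍ) : ℂ)‖ < R := fun z hz => h2 ⟨z, hz, rfl⟩
  have i2 := side2 R hR A⁻¹ h2'
  have hinv : ((A⁻¹ : SL2) : Matrix (Fin 2) (Fin 2) ℝ) = !![A 1 1, -A 0 1; -A 1 0, A 0 0] := by
    rw [Matrix.SpecialLinearGroup.coe_inv, Matrix.adjugate_fin_two]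
  obtain ⟨e, he, hfacts⟩ := @real_facts R (1 / R ^ 2) (A 0 0) (A 0 1) (A 1 0) (A 1 1) hR rfl
    (fun σ τ hσ hτ => corner R hR A hsup hσ hτ) (fun τ hτ => side1 R hR A hcl h1' hτ)
    (by rw [hinv] at i2; simpa [sub_eq_add_neg] using i2)
  obtain ⟨B, hB, hBe⟩ : ∃ B : SL2, (QuotientGroup.mk B : PSL2) = QuotientGroup.mk A ∧
      ∀ i j, B i j = e * A i j := by
    rcases he with rfl | rfl
    · exact ⟨A, rfl, by simp⟩
    · exact ⟨-A, mk_neg_eq A, by intro i j; rw [Matrix.SpecialLinearGroup.coe_neg]; simp⟩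
  clear h1 h2 hsup hcl hact hact' h1' h2' i2 hinv
  rw [← hB]
  have hq0 : 0 < 1 / R ^ 2 := by positivity
  have hq1 : 1 / R ^ 2 < 1 := by rw [div_lt_one (by positivity)]; nlinarith
  have hdB := B.2
  rw [Matrix.det_fin_two] at hdB
  obtain ⟨f1, f2, f3, f4, f5, f6, f7, f8⟩ := hfacts (B 0 0) (B 1 0 / R) (B 1 1 / R ^ 2) (B 0 1 / R)
    (by rw [hBe]) (by rw [hBe]; ring) (by rw [hBe]; ring) (by rw [hBe]; ring)
  have c1 := core_s18 hq0 hq1 (by field_simp; linarith) f1 f2 f3 f4 f5 f6 f7 f8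
  have c2 := @core_s18 (1 / R ^ 2) (B 0 0) (-(B 0 1 / R)) (B 1 1 / R ^ 2) (-(B 1 0 / R)) hq0 hq1
    (by field_simp; linarith) (by linarith) (by linarith)
    (by linarith) (by linarith) (by linarith) (by linarith) (by linarith) (by linarith)
  have hm1 : ∀ ε : ℝ, (ε = 1 ∨ ε = -1) → ((∃ t > 0, (QuotientGroup.mk B : PSL2) * P' ε t ∈ SQell R) ↔
      ∃ t > 0, Qt (1 / R ^ 2) (B 0 0) (B 1 0 / R) (B 1 1 / R ^ 2) (B 0 1 / R) ε t) := by
    intro ε hε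
    refine exists_congr fun t => and_congr_right fun _ => ?_
    obtain ⟨T, hT, hTm⟩ := hP' ε hε t
    rw [← hT, ← QuotientGroup.mk_mul, SQell_mk R hR, Qt, Matrix.SpecialLinearGroup.coe_mul, hTm,
      Matrix.mul_apply, Matrix.mul_apply, Matrix.mul_apply, Matrix.mul_apply]
    simp only [Fin.sum_univ_two]
    apply iff_of_eq
    congr 1 <;> simp <;> field_simp <;> ring
  have hm2 : ∀ ε : ℝ, (ε = 1 ∨ ε = -1) →
      ((∃ t > 0, (P ε t)⁻¹ * (QuotientGroup.mk B : PSL2) ∈ SQell'inv R) ↔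
      ∃ t > 0, Qt (1 / R ^ 2) (B 0 0) (-(B 0 1 / R)) (B 1 1 / R ^ 2) (-(B 1 0 / R)) (-ε) t) := by
    intro ε hε
    refine exists_congr fun t => and_congr_right fun _ => ?_
    obtain ⟨T, hT, hTm⟩ := hP ε hε t
    rw [← hT, ← QuotientGroup.mk_inv, ← QuotientGroup.mk_mul, SQinv_mk R hR, Qt,
      Matrix.SpecialLinearGroup.coe_mul, Matrix.SpecialLinearGroup.coe_inv, hTm,
      Matrix.adjugate_fin_two,
      Matrix.mul_apply, Matrix.mul_apply, Matrix.mul_apply, Matrix.mul_apply]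
    simp only [Fin.sum_univ_two]
    apply iff_of_eq
    congr 1 <;> simp <;> field_simp <;> ring
  rw [hm1 1 (Or.inl rfl), hm1 (-1) (Or.inr rfl), hm2 1 (Or.inl rfl), hm2 (-1) (Or.inr rfl),
    SQell_mk R hR, SQinv_mk R hR, neg_neg]
  refine ⟨c1, ?_⟩
  rcases c2 with ⟨x, y, z⟩ | ⟨x, y, z⟩ | ⟨x, y, z⟩
  · exact Or.inl ⟨x, z, y⟩
  · exact Or.inr (Or.inr ⟨x, z, y⟩)
  · exact Or.inr (Or.inl ⟨x, z, y⟩)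

end
end
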